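/- arXiv:1212.5971 — 4 statements merged into one kernel-verified Lean document; each statement's English description precedes it below -/
import Mathlib

section
/- For every real number q with 0 < q < 1, the Virasoro minimal model character χ_{2,5}^{1,1} satisfies the Rogers–Ramanujan product identity χ_{2,5}^{1,1}(q) = q^{11/60} · ∏_{n=0}^∞ 1/((1 − q^{5n+2})(1 − q^{5n+3})). Equivalently, (q)_∞^{−1} · Σ_{k∈ℤ} q^{10k²}(q^{3k} − q^{7k+1}) = ∏_{n=0}^∞ 1/((1 − q^{5n+2})(1 − q^{5n+3})). -/
open scoped BigOperators

/-- The Euler product `(q)_∞ = ∏_{i=1}^∞ (1 - q^i)`. -/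
noncomputable def eulerProd (q : ℝ) : ℝ := ∏' i : ℕ, (1 - q ^ (i + 1))

/-- The Virasoro minimal model character `χ_{s,t}^{m,n}(q)`:
`q^(h - c/24) · (q)_∞⁻¹ · Σ_{k∈ℤ} q^(s t k²) (q^(k(mt-ns)) - q^((mt+ns)k+mn))`,
where `c = 1 - 6(s-t)²/(st)` and `h = ((mt-ns)² - (s-t)²)/(4st)`. -/
noncomputable def minChar (s t m n : ℤ) (q : ℝ) : ℝ :=
  q ^ ((((((m * t - n * s) ^ 2 - (s - t) ^ 2 : ℤ) : ℝ)) / (4 * (s : ℝ) * (t : ℝ))) -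
        (1 - 6 * ((s : ℝ) - (t : ℝ)) ^ 2 / ((s : ℝ) * (t : ℝ))) / 24) *
    (eulerProd q)⁻¹ *
    ∑' k : ℤ, ((q ^ (s * t * k ^ 2 + k * (m * t - n * s)) : ℝ) -
               (q ^ (s * t * k ^ 2 + (m * t + n * s) * k + m * n) : ℝ))

section

open Filter Topology Finset

section GaussianBinomial

/-- The finite Euler product `(Q)_n = ∏_{i=1}^n (1 - Q^i)`. -/
noncomputable def eulerProdFin (Q : ℝ) (n : ℕ) : ℝ := ∏ i ∈ range n, (1 - Q ^ (i + 1))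

/-- The Gaussian binomial coefficient, defined by the `q`-Pascal recursion. -/
noncomputable def gaussBinom (Q : ℝ) : ℕ → ℕ → ℝ
  | _, 0 => 1
  | 0, _ + 1 => 0
  | n + 1, k + 1 => gaussBinom Q n k + Q ^ (k + 1) * gaussBinom Q n (k + 1)

variable (Q : ℝ)

@[simp]
lemma gaussBinom_zero_right (n : ℕ) : gaussBinom Q n 0 = 1 := by
  cases n <;> rfl

lemma gaussBinom_succ_succ (n k : ℕ) :
    gaussBinom Q (n + 1) (k + 1) = gaussBinom Q n k + Q ^ (k + 1) * gaussBinom Q n (k + 1) :=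
  rfl

lemma gaussBinom_eq_zero_of_lt (n k : ℕ) (h : n < k) : gaussBinom Q n k = 0 := by
  induction n generalizing k with
  | zero =>
    obtain ⟨k, rfl⟩ := Nat.exists_eq_succ_of_ne_zero h.ne'
    rfl
  | succ n ih =>
    obtain ⟨k, rfl⟩ := Nat.exists_eq_succ_of_ne_zero (by omega : k ≠ 0)
    rw [Nat.succ_eq_add_one, gaussBinom_succ_succ, ih k (by omega), ih (k + 1) (by omega)]
    simp

@[simp]
lemma gaussBinom_self (n : ℕ) : gaussBinom Q n n = 1 := by
  induction n with
  | zero => rfl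
  | succ n ih => rw [gaussBinom_succ_succ, ih, gaussBinom_eq_zero_of_lt Q n (n + 1) (by omega)]; simp

lemma eulerProdFin_succ (n : ℕ) :
    eulerProdFin Q (n + 1) = eulerProdFin Q n * (1 - Q ^ (n + 1)) :=
  prod_range_succ _ _

lemma gaussBinom_mul_eulerProdFin (a b : ℕ) :
    gaussBinom Q (a + b) a * (eulerProdFin Q a * eulerProdFin Q b) = eulerProdFin Q (a + b) := by
  induction a generalizing b with
  | zero => simp [eulerProdFin]
  | succ a iha =>
    induction b with
    | zero => simp [eulerProdFin]
    | succ b ihb =>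
      have h := iha (b + 1)
      rw [show a + 1 + (b + 1) = (a + 1 + b) + 1 by ring, gaussBinom_succ_succ,
        eulerProdFin_succ Q (a + 1 + b)]
      rw [show a + (b + 1) = a + 1 + b by ring] at h
      rw [eulerProdFin_succ] at h ihb
      rw [eulerProdFin_succ, eulerProdFin_succ]
      linear_combination (1 - Q ^ (a + 1)) * h + Q ^ (a + 1) * (1 - Q ^ (b + 1)) * ihb

/-- The `q`-binomial theorem. -/
lemma prod_one_add_mul_pow (y : ℝ) (n : ℕ) :
    ∏ j ∈ range n, (1 + y * Q ^ j) =
      ∑ k ∈ range (n + 1), gaussBinom Q n k * (Q ^ k.choose 2 * y ^ k) := by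
  induction n generalizing y with
  | zero => simp
  | succ n ih =>
    have h : ∏ j ∈ range n, (1 + y * Q ^ (j + 1)) = ∏ j ∈ range n, (1 + y * Q * Q ^ j) :=
      prod_congr rfl fun j _ ↦ by ring
    have h₁ : ∑ k ∈ range (n + 1), gaussBinom Q n k * (Q ^ k.choose 2 * (y * Q) ^ k) =
        ∑ k ∈ range (n + 1),
          gaussBinom Q n (k + 1) * (Q ^ (k + 1).choose 2 * (y * Q) ^ (k + 1)) + 1 := by
      rw [sum_range_succ', sum_range_succ _ n, gaussBinom_eq_zero_of_lt Q n (n + 1) (by omega)]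
      simp
    rw [prod_range_succ', h, ih, sum_range_succ' _ (n + 1), pow_zero, mul_one, mul_add, mul_one]
    nth_rewrite 1 [h₁]
    rw [sum_mul, add_right_comm, ← sum_add_distrib]
    simp only [gaussBinom_zero_right, Nat.choose_zero_succ, pow_zero, mul_one]
    congr 1
    refine sum_congr rfl fun k _ ↦ ?_
    rw [gaussBinom_succ_succ, Nat.choose_succ_succ' k 1, Nat.choose_one_right]
    ring

end GaussianBinomial

section EulerProduct

variable {Q : ℝ}

lemma summable_norm_neg_pow_mul_add (h0 : 0 < Q) (h1 : Q < 1) {a : ℕ} (ha : a ≠ 0) (b : ℕ) :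
    Summable fun i : ℕ ↦ ‖-Q ^ (a * i + b)‖ := by
  have h : Summable fun i : ℕ ↦ Q ^ b * (Q ^ a) ^ i :=
    (summable_geometric_of_lt_one (by positivity) (pow_lt_one₀ h0.le h1 ha)).mul_left _
  refine h.congr fun i ↦ ?_
  rw [norm_neg, Real.norm_of_nonneg (by positivity), pow_add, pow_mul, mul_comm]

lemma multipliable_one_sub_pow_mul_add (h0 : 0 < Q) (h1 : Q < 1) {a : ℕ} (ha : a ≠ 0) (b : ℕ) :
    Multipliable fun i : ℕ ↦ 1 - Q ^ (a * i + b) := by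
  simpa only [sub_eq_add_neg] using
    multipliable_one_add_of_summable (summable_norm_neg_pow_mul_add h0 h1 ha b)

lemma tendsto_eulerProdFin (h0 : 0 < Q) (h1 : Q < 1) :
    Tendsto (eulerProdFin Q) atTop (𝓝 (eulerProd Q)) := by
  have h := (multipliable_one_sub_pow_mul_add h0 h1 one_ne_zero 1).hasProd.tendsto_prod_nat
  simp only [one_mul] at h
  exact h

lemma eulerProd_ne_zero (h0 : 0 < Q) (h1 : Q < 1) : eulerProd Q ≠ 0 := by
  have h := tprod_one_add_ne_zero_of_summable (f := fun i : ℕ ↦ -Q ^ (i + 1))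
    (fun i ↦ by
      rw [← sub_eq_add_neg]
      exact (sub_pos.2 (pow_lt_one₀ h0.le h1 i.succ_ne_zero)).ne')
    (by simpa only [one_mul] using summable_norm_neg_pow_mul_add h0 h1 one_ne_zero 1)
  simp only [← sub_eq_add_neg] at h
  exact h

lemma eulerProdFin_pos (h0 : 0 < Q) (h1 : Q < 1) (n : ℕ) : 0 < eulerProdFin Q n :=
  prod_pos fun i _ ↦ sub_pos.2 (pow_lt_one₀ h0.le h1 i.succ_ne_zero)

lemma eulerProd_pos (h0 : 0 < Q) (h1 : Q < 1) : 0 < eulerProd Q :=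
  (ge_of_tendsto' (tendsto_eulerProdFin h0 h1) fun n ↦ (eulerProdFin_pos h0 h1 n).le).lt_of_ne'
    (eulerProd_ne_zero h0 h1)

lemma eulerProdFin_le_one (h0 : 0 < Q) (h1 : Q < 1) (n : ℕ) : eulerProdFin Q n ≤ 1 :=
  prod_le_one (fun i _ ↦ sub_nonneg.2 (pow_le_one₀ h0.le h1.le))
    fun i _ ↦ sub_le_self _ (by positivity)

lemma eulerProd_le_eulerProdFin (h0 : 0 < Q) (h1 : Q < 1) (n : ℕ) :
    eulerProd Q ≤ eulerProdFin Q n := by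
  refine Antitone.le_of_tendsto (antitone_nat_of_succ_le fun n ↦ ?_)
    (tendsto_eulerProdFin h0 h1) n
  rw [eulerProdFin_succ]
  exact mul_le_of_le_one_right (eulerProdFin_pos h0 h1 n).le (sub_le_self _ (by positivity))

lemma gaussBinom_eq_div (h0 : 0 < Q) (h1 : Q < 1) (a b : ℕ) :
    gaussBinom Q (a + b) a = eulerProdFin Q (a + b) / (eulerProdFin Q a * eulerProdFin Q b) :=
  eq_div_of_mul_eq (mul_pos (eulerProdFin_pos h0 h1 a) (eulerProdFin_pos h0 h1 b)).ne'
    (gaussBinom_mul_eulerProdFin Q a b)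

lemma abs_gaussBinom_le (h0 : 0 < Q) (h1 : Q < 1) (n k : ℕ) :
    |gaussBinom Q n k| ≤ (eulerProd Q ^ 2)⁻¹ := by
  have hE := eulerProd_pos h0 h1
  rcases lt_or_ge n k with h | h
  · rw [gaussBinom_eq_zero_of_lt Q n k h, abs_zero]
    positivity
  · obtain ⟨b, rfl⟩ := Nat.exists_eq_add_of_le h
    have hk := eulerProdFin_pos h0 h1 k
    have hb := eulerProdFin_pos h0 h1 b
    have hkb := eulerProdFin_pos h0 h1 (k + b)
    rw [gaussBinom_eq_div h0 h1, abs_of_pos (by positivity), ← one_div, sq]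
    have := eulerProd_le_eulerProdFin h0 h1 k
    have := eulerProd_le_eulerProdFin h0 h1 b
    have := eulerProdFin_le_one h0 h1 (k + b)
    gcongr

lemma tendsto_gaussBinom (h0 : 0 < Q) (h1 : Q < 1) (k : ℤ) :
    Tendsto (fun N : ℕ ↦ gaussBinom Q (2 * N) (k + N).toNat) atTop (𝓝 (eulerProd Q)⁻¹) := by
  have hE := eulerProd_ne_zero h0 h1
  have ht := tendsto_eulerProdFin h0 h1
  have hadd : Tendsto (fun N : ℕ ↦ (k + N).toNat) atTop atTop :=
    tendsto_atTop.2 fun b ↦ by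
      filter_upwards [eventually_ge_atTop (b + k.natAbs)] with N hN
      omega
  have hsub : Tendsto (fun N : ℕ ↦ (N - k).toNat) atTop atTop :=
    tendsto_atTop.2 fun b ↦ by
      filter_upwards [eventually_ge_atTop (b + k.natAbs)] with N hN
      omega
  have h2 : Tendsto (fun N : ℕ ↦ 2 * N) atTop atTop :=
    tendsto_atTop.2 fun b ↦ by
      filter_upwards [eventually_ge_atTop b] with N hN
      omega
  have h := (ht.comp h2).div ((ht.comp hadd).mul (ht.comp hsub)) (mul_ne_zero hE hE)
  rw [div_mul_cancel_left₀ hE] at h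
  refine h.congr' ?_
  filter_upwards [eventually_ge_atTop k.natAbs] with N hN
  have hN' : 2 * N = (k + N).toNat + (N - k).toNat := by omega
  simp only [Function.comp_apply, Pi.div_apply]
  rw [hN', gaussBinom_eq_div h0 h1]

end EulerProduct

section JacobiTripleProduct

variable {Q y : ℝ} {T : ℤ → ℝ}

lemma ne_zero_of_theta_recursion (h0 : 0 < Q) (hy : y ≠ 0) (hT0 : T 0 = 1)
    (hT : ∀ k : ℤ, T (k + 1) = y * Q ^ k * T k) (k : ℤ) : T k ≠ 0 := by
  induction k with
  | zero => simp [hT0]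
  | succ k ih =>
    rw [hT]
    exact mul_ne_zero (mul_ne_zero hy (zpow_ne_zero _ h0.ne')) ih
  | pred k ih =>
    intro h
    apply ih
    have := hT (-k - 1)
    rw [h, mul_zero, sub_add_cancel] at this
    exact this

lemma theta_neg_succ (h0 : 0 < Q) (hy : y ≠ 0) (hT : ∀ k : ℤ, T (k + 1) = y * Q ^ k * T k)
    (n : ℕ) : T (-((n + 1 : ℕ) : ℤ)) = y⁻¹ * Q ^ (n + 1) * T (-(n : ℤ)) := by
  have h := hT (-((n + 1 : ℕ) : ℤ))
  rw [show -((n + 1 : ℕ) : ℤ) + 1 = -(n : ℤ) by push_cast; ring, zpow_neg, zpow_natCast] at h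
  have : Q ≠ 0 := h0.ne'
  rw [h]
  field_simp

lemma summable_of_theta_recursion (h0 : 0 < Q) (h1 : Q < 1) (hy : y ≠ 0) (hT0 : T 0 = 1)
    (hT : ∀ k : ℤ, T (k + 1) = y * Q ^ k * T k) : Summable T := by
  have hne := ne_zero_of_theta_recursion h0 hy hT0 hT
  have hpow : Tendsto (fun n : ℕ ↦ Q ^ n) atTop (𝓝 0) :=
    tendsto_pow_atTop_nhds_zero_of_lt_one h0.le h1
  refine Summable.of_nat_of_neg ?_ ?_
  · refine summable_of_ratio_test_tendsto_lt_one (l := 0) one_pos (.of_forall fun n ↦ hne n) ?_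
    have h : Tendsto (fun n : ℕ ↦ ‖y * Q ^ n‖) atTop (𝓝 0) := by
      simpa using (hpow.const_mul y).norm
    refine h.congr fun n ↦ ?_
    rw [Nat.cast_add_one, hT, zpow_natCast, norm_mul _ (T n),
      mul_div_cancel_right₀ _ (norm_ne_zero_iff.2 (hne n))]
  · refine summable_of_ratio_test_tendsto_lt_one (l := 0) one_pos (.of_forall fun n ↦ hne _) ?_
    have h : Tendsto (fun n : ℕ ↦ ‖y⁻¹ * Q ^ (n + 1)‖) atTop (𝓝 0) := by
      simpa using (((tendsto_add_atTop_iff_nat 1).2 hpow).const_mul y⁻¹).norm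
    refine h.congr fun n ↦ ?_
    rw [theta_neg_succ h0 hy hT, norm_mul _ (T (-n)),
      mul_div_cancel_right₀ _ (norm_ne_zero_iff.2 (hne _))]

lemma theta_sub (h0 : 0 < Q) (hT : ∀ k : ℤ, T (k + 1) = y * Q ^ k * T k) (N i : ℕ) :
    T (i - N) = T (-N) * (Q ^ i.choose 2 * (y * (Q ^ N)⁻¹) ^ i) := by
  induction i with
  | zero => simp
  | succ i ih =>
    rw [show ((i + 1 : ℕ) : ℤ) - N = (i - N : ℤ) + 1 by push_cast; ring, hT, ih,
      zpow_sub₀ h0.ne', zpow_natCast, zpow_natCast, Nat.choose_succ_succ' i 1,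
      Nat.choose_one_right]
    ring

lemma theta_neg_mul_prod (h0 : 0 < Q) (hy : y ≠ 0) (hT0 : T 0 = 1)
    (hT : ∀ k : ℤ, T (k + 1) = y * Q ^ k * T k) (N : ℕ) :
    T (-N) * ∏ j ∈ range (2 * N), (1 + y * (Q ^ N)⁻¹ * Q ^ j) =
      ∏ j ∈ range N, ((1 + y * Q ^ j) * (1 + y⁻¹ * Q ^ (j + 1))) := by
  have hQ : Q ≠ 0 := h0.ne'
  induction N with
  | zero => simp [hT0]
  | succ N ih =>
    have h : ∏ j ∈ range (2 * N), (1 + y * (Q ^ (N + 1))⁻¹ * Q ^ (j + 1)) =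
        ∏ j ∈ range (2 * N), (1 + y * (Q ^ N)⁻¹ * Q ^ j) :=
      prod_congr rfl fun j _ ↦ by
        field_simp
        ring
    rw [prod_range_succ _ N, ← ih, show 2 * (N + 1) = 2 * N + 1 + 1 by ring, prod_range_succ,
      prod_range_succ', h, theta_neg_succ h0 hy hT]
    field_simp
    ring

/-- The finite form of the Jacobi triple product identity. -/
lemma prod_eq_tsum_gaussBinom (h0 : 0 < Q) (hy : y ≠ 0) (hT0 : T 0 = 1)
    (hT : ∀ k : ℤ, T (k + 1) = y * Q ^ k * T k) (N : ℕ) :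
    ∏ j ∈ range N, ((1 + y * Q ^ j) * (1 + y⁻¹ * Q ^ (j + 1))) =
      ∑' k : ℤ, if -(N : ℤ) ≤ k then gaussBinom Q (2 * N) (k + N).toNat * T k else 0 := by
  have hinj : Function.Injective fun i : ℕ ↦ (i : ℤ) - N := fun i j h ↦ by
    simpa using h
  rw [← hinj.tsum_eq, tsum_eq_sum (s := range (2 * N + 1)), ← theta_neg_mul_prod h0 hy hT0 hT,
    prod_one_add_mul_pow, mul_sum]
  · refine sum_congr rfl fun i _ ↦ ?_
    rw [if_pos (by omega), theta_sub h0 hT, sub_add_cancel, Int.toNat_natCast]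
    ring
  · intro i hi
    rw [mem_range, not_lt] at hi
    rw [sub_add_cancel, Int.toNat_natCast, gaussBinom_eq_zero_of_lt Q _ i (by omega)]
    simp
  · intro k hk
    have hk' : -(N : ℤ) ≤ k := by
      by_contra h
      exact hk (if_neg h)
    exact ⟨(k + N).toNat, by dsimp only; omega⟩

/-- The Jacobi triple product identity, for a theta series `T` given by its two-term recursion. -/
lemma tendsto_prod_theta (h0 : 0 < Q) (h1 : Q < 1) (hy : y ≠ 0) (hT0 : T 0 = 1)
    (hT : ∀ k : ℤ, T (k + 1) = y * Q ^ k * T k) :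
    Tendsto (fun N : ℕ ↦ ∏ j ∈ range N, ((1 + y * Q ^ j) * (1 + y⁻¹ * Q ^ (j + 1)))) atTop
      (𝓝 ((eulerProd Q)⁻¹ * ∑' k, T k)) := by
  simp only [prod_eq_tsum_gaussBinom h0 hy hT0 hT]
  rw [← tsum_mul_left]
  refine tendsto_tsum_of_dominated_convergence
    ((summable_of_theta_recursion h0 h1 hy hT0 hT).norm.mul_left (eulerProd Q ^ 2)⁻¹)
    (fun k ↦ ?_) (.of_forall fun N k ↦ ?_)
  · refine ((tendsto_gaussBinom h0 h1 k).mul_const (T k)).congr' ?_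
    filter_upwards [eventually_ge_atTop k.natAbs] with N hN
    rw [if_pos (by omega)]
  · split_ifs
    · rw [norm_mul]
      exact mul_le_mul_of_nonneg_right (abs_gaussBinom_le h0 h1 _ _) (norm_nonneg _)
    · rw [norm_zero]
      positivity

end JacobiTripleProduct

lemma Summable.tsum_int_even_add_neg_odd {f : ℤ → ℝ} (hf : Summable f) :
    ∑' k : ℤ, (f (2 * k) + f (-(2 * k + 1))) = ∑' k, f k := by
  have he : Function.Injective fun k : ℤ ↦ 2 * k := fun a b h ↦ by
    dsimp only at h; omega
  have ho : Function.Injective fun k : ℤ ↦ -(2 * k + 1) := fun a b h ↦ by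
    dsimp only at h; omega
  have hse : Summable fun k : ℤ ↦ f (2 * k) := hf.comp_injective he
  have hso : Summable fun k : ℤ ↦ f (-(2 * k + 1)) := hf.comp_injective ho
  have hcompl : IsCompl (Set.range fun k : ℤ ↦ 2 * k) (Set.range fun k : ℤ ↦ -(2 * k + 1)) := by
    rw [isCompl_iff, Set.disjoint_iff, codisjoint_iff]
    constructor
    · rintro _ ⟨⟨a, rfl⟩, b, h⟩
      dsimp only at h
      omega
    · refine Set.eq_univ_of_forall fun k ↦ ?_
      rcases Int.even_or_odd' k with ⟨m, h | h⟩
      · exact .inl ⟨m, h.symm⟩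
      · exact .inr ⟨-m - 1, by dsimp only; omega⟩
  rw [hse.tsum_add hso]
  exact ((he.hasSum_range_iff.2 hse.hasSum).add_isCompl hcompl
    (ho.hasSum_range_iff.2 hso.hasSum)).tsum_eq.symm

section RogersRamanujan

variable {q : ℝ}

lemma rogersRamanujan_theta_recursion (h0 : 0 < q) (k : ℤ) :
    (-1 : ℝ) ^ (k + 1) * q ^ ((k + 1) * (5 * (k + 1) + 3) / 2) =
      -q ^ 4 * (q ^ 5) ^ k * ((-1) ^ k * q ^ (k * (5 * k + 3) / 2)) := by
  have hexp : (k + 1) * (5 * (k + 1) + 3) / 2 = 4 + (5 * k + k * (5 * k + 3) / 2) := by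
    rw [show (k + 1) * (5 * (k + 1) + 3) = k * (5 * k + 3) + (4 + 5 * k) * 2 by ring,
      Int.add_mul_ediv_right _ _ two_ne_zero]
    ring
  rw [hexp, zpow_add₀ h0.ne', zpow_add₀ h0.ne', zpow_mul, zpow_add_one₀ (by norm_num),
    zpow_ofNat, zpow_ofNat]
  ring

lemma tsum_rogersRamanujan_theta (h0 : 0 < q) (h1 : q < 1) :
    ∑' k : ℤ, (q ^ (10 * k ^ 2 + 3 * k) - q ^ (10 * k ^ 2 + 7 * k + 1)) =
      ∑' k : ℤ, (-1 : ℝ) ^ k * q ^ (k * (5 * k + 3) / 2) := by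
  have hs : Summable fun k : ℤ ↦ (-1 : ℝ) ^ k * q ^ (k * (5 * k + 3) / 2) :=
    summable_of_theta_recursion (pow_pos h0 5) (pow_lt_one₀ h0.le h1 (by norm_num))
      (neg_ne_zero.2 (pow_pos h0 4).ne') (by simp) (rogersRamanujan_theta_recursion h0)
  rw [← hs.tsum_int_even_add_neg_odd]
  refine tsum_congr fun k ↦ ?_
  rw [(even_two_mul k).neg_one_zpow, (odd_two_mul_add_one k).neg.neg_one_zpow,
    show 2 * k * (5 * (2 * k) + 3) = (10 * k ^ 2 + 3 * k) * 2 by ring,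
    show -(2 * k + 1) * (5 * -(2 * k + 1) + 3) = (10 * k ^ 2 + 7 * k + 1) * 2 by ring,
    Int.mul_ediv_cancel _ two_ne_zero, Int.mul_ediv_cancel _ two_ne_zero]
  ring

lemma eulerProdFin_five_mul (h0 : 0 < q) (N : ℕ) :
    eulerProdFin q (5 * N) = eulerProdFin (q ^ 5) N *
      (∏ j ∈ range N, ((1 + -q ^ 4 * (q ^ 5) ^ j) * (1 + (-q ^ 4)⁻¹ * (q ^ 5) ^ (j + 1)))) *
      ∏ j ∈ range N, ((1 - q ^ (5 * j + 2)) * (1 - q ^ (5 * j + 3))) := by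
  have hq : q ≠ 0 := h0.ne'
  induction N with
  | zero => simp [eulerProdFin]
  | succ N ih =>
    have h : (-q ^ 4)⁻¹ * (q ^ 5) ^ (N + 1) = -q ^ (5 * N + 1) := by
      field_simp
      ring
    rw [show 5 * (N + 1) = 5 * N + 1 + 1 + 1 + 1 + 1 by ring]
    simp only [eulerProdFin_succ, prod_range_succ]
    rw [ih, h]
    ring

/-- The theta series equals the product side of the Rogers–Ramanujan identity, cleared of
denominators. -/
lemma eulerProd_eq_tsum_mul_tprod (h0 : 0 < q) (h1 : q < 1) :
    eulerProd q = (∑' k : ℤ, (q ^ (10 * k ^ 2 + 3 * k) - q ^ (10 * k ^ 2 + 7 * k + 1))) *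
      ∏' n : ℕ, ((1 - q ^ (5 * n + 2)) * (1 - q ^ (5 * n + 3))) := by
  have hQ0 : 0 < q ^ 5 := pow_pos h0 5
  have hQ1 : q ^ 5 < 1 := pow_lt_one₀ h0.le h1 (by norm_num)
  have hB : Multipliable fun n : ℕ ↦ (1 - q ^ (5 * n + 2)) * (1 - q ^ (5 * n + 3)) :=
    (multipliable_one_sub_pow_mul_add h0 h1 (by norm_num) 2).mul
      (multipliable_one_sub_pow_mul_add h0 h1 (by norm_num) 3)
  have htheta := tendsto_prod_theta (T := fun k ↦ (-1 : ℝ) ^ k * q ^ (k * (5 * k + 3) / 2))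
    hQ0 hQ1 (neg_ne_zero.2 (pow_pos h0 4).ne') (by simp) (rogersRamanujan_theta_recursion h0)
  have hright := ((tendsto_eulerProdFin hQ0 hQ1).mul htheta).mul hB.hasProd.tendsto_prod_nat
  rw [mul_inv_cancel_left₀ (eulerProd_ne_zero hQ0 hQ1), ← tsum_rogersRamanujan_theta h0 h1] at hright
  have hleft : Tendsto (fun N : ℕ ↦ eulerProdFin q (5 * N)) atTop (𝓝 (eulerProd q)) :=
    (tendsto_eulerProdFin h0 h1).comp
      (tendsto_id.const_mul_atTop' (by norm_num : (0 : ℕ) < 5))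
  simp only [eulerProdFin_five_mul h0] at hleft
  exact tendsto_nhds_unique hleft hright

lemma inv_eulerProd_mul_tsum (h0 : 0 < q) (h1 : q < 1) :
    (eulerProd q)⁻¹ *
        (∑' k : ℤ, (q ^ (10 * k ^ 2 + 3 * k) - q ^ (10 * k ^ 2 + 7 * k + 1))) =
      ∏' n : ℕ, ((1 - q ^ (5 * n + 2)) * (1 - q ^ (5 * n + 3)))⁻¹ := by
  have hE := eulerProd_ne_zero h0 h1
  have h := eulerProd_eq_tsum_mul_tprod h0 h1
  have hB : Multipliable fun n : ℕ ↦ (1 - q ^ (5 * n + 2)) * (1 - q ^ (5 * n + 3)) :=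
    (multipliable_one_sub_pow_mul_add h0 h1 (by norm_num) 2).mul
      (multipliable_one_sub_pow_mul_add h0 h1 (by norm_num) 3)
  have hS := left_ne_zero_of_mul (h ▸ hE)
  have hP := right_ne_zero_of_mul (h ▸ hE)
  rw [hB.tprod_inv₀ hP, h, mul_inv, mul_right_comm, inv_mul_cancel₀ hS, one_mul]

end RogersRamanujan

end

theorem rogers_ramanujan_chi_2_5_1_1 (q : ℝ) (hq0 : 0 < q) (hq1 : q < 1) :
    minChar 2 5 1 1 q =
      q ^ ((11 : ℝ) / 60) * ∏' n : ℕ, ((1 - q ^ (5 * n + 2)) * (1 - q ^ (5 * n + 3)))⁻¹ ∧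
    (eulerProd q)⁻¹ *
        (∑' k : ℤ, ((q ^ (10 * k ^ 2 + 3 * k) : ℝ) - (q ^ (10 * k ^ 2 + 7 * k + 1) : ℝ))) =
      ∏' n : ℕ, ((1 - q ^ (5 * n + 2)) * (1 - q ^ (5 * n + 3)))⁻¹ := by
  have h := inv_eulerProd_mul_tsum hq0 hq1
  refine ⟨?_, h⟩
  rw [← h, minChar, mul_assoc]
  refine congrArg₂ _ (congrArg _ (by norm_num)) (congrArg _ (tsum_congr fun k ↦ ?_))
  exact congrArg₂ _ (congrArg _ (by ring)) (congrArg _ (by ring))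
end

section
/- For every real number q with 0 < q < 1, the following identity between minimal model characters of central charges 4/5 and −22/5 holds: χ_{5,6}^{1,2}(q) + χ_{5,6}^{1,4}(q) = χ_{2,5}^{1,1}(q^{1/2}). -/
open scoped BigOperators

open Filter Topology Finset

/-- The `q`-Pochhammer symbol `(a; b)_∞ = ∏_{k ≥ 0} (1 - a b^k)`. -/
noncomputable def qPoch (a b : ℝ) : ℝ := ∏' k : ℕ, (1 - a * b ^ k)

section qPoch

variable {a b : ℝ}

lemma summable_norm_mul_pow (a : ℝ) (hb0 : 0 < b) (hb1 : b < 1) :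
    Summable fun k : ℕ ↦ ‖-(a * b ^ k)‖ := by
  simp only [norm_neg, norm_mul, norm_pow]
  refine (summable_geometric_of_lt_one (norm_nonneg b) ?_).mul_left _
  rwa [Real.norm_of_nonneg hb0.le]

lemma tendsto_qPoch (a : ℝ) (hb0 : 0 < b) (hb1 : b < 1) :
    Tendsto (fun n : ℕ ↦ ∏ k ∈ range n, (1 - a * b ^ k)) atTop (𝓝 (qPoch a b)) := by
  have h := multipliable_one_add_of_summable (summable_norm_mul_pow a hb0 hb1)
  simpa only [qPoch, ← sub_eq_add_neg] using h.tendsto_prod_tprod_nat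

lemma qPoch_ne_zero (hb0 : 0 < b) (hb1 : b < 1) (ha : |a| < 1) : qPoch a b ≠ 0 := by
  have h : ∀ k : ℕ, 1 + -(a * b ^ k) ≠ 0 := by
    intro k h
    have h1 : a * b ^ k = 1 := by linarith
    have h2 : |a * b ^ k| < 1 := by
      rw [abs_mul, abs_of_pos (pow_pos hb0 k)]
      exact mul_lt_one_of_nonneg_of_lt_one_left (abs_nonneg a) ha (pow_le_one₀ hb0.le hb1.le)
    rw [h1, abs_one] at h2
    exact lt_irrefl _ h2
  simpa only [qPoch, ← sub_eq_add_neg] using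
    tprod_one_add_ne_zero_of_summable h (summable_norm_mul_pow a hb0 hb1)

/-- Dissection of a `q`-Pochhammer symbol modulo `N`. -/
lemma qPoch_eq_prod_range (a : ℝ) (hb0 : 0 < b) (hb1 : b < 1) {N : ℕ} (hN : N ≠ 0) :
    qPoch a b = ∏ r ∈ range N, qPoch (a * b ^ r) (b ^ N) := by
  have h1 : Tendsto (fun n : ℕ ↦ ∏ k ∈ range (N * n), (1 - a * b ^ k)) atTop (𝓝 (qPoch a b)) :=
    (tendsto_qPoch a hb0 hb1).comp (tendsto_id.const_mul_atTop' (Nat.pos_of_ne_zero hN))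
  have h2 : Tendsto (fun n : ℕ ↦ ∏ r ∈ range N, ∏ k ∈ range n, (1 - a * b ^ r * (b ^ N) ^ k)) atTop
      (𝓝 (∏ r ∈ range N, qPoch (a * b ^ r) (b ^ N))) :=
    tendsto_finsetProd _ fun r _ ↦
      tendsto_qPoch _ (pow_pos hb0 N) (pow_lt_one₀ hb0.le hb1 hN)
  refine tendsto_nhds_unique h1 (h2.congr fun n ↦ ?_)
  induction n with
  | zero => simp
  | succ n ih =>
    simp only [prod_range_succ _ n, prod_mul_distrib, ih, Nat.mul_succ, prod_range_add]
    congr 1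
    refine prod_congr rfl fun r _ ↦ ?_
    ring

lemma qPoch_mul_qPoch_neg (a : ℝ) (hb0 : 0 < b) (hb1 : b < 1) :
    qPoch a b * qPoch (-a) b = qPoch (a ^ 2) (b ^ 2) := by
  refine tendsto_nhds_unique ((tendsto_qPoch a hb0 hb1).mul (tendsto_qPoch (-a) hb0 hb1))
    ((tendsto_qPoch (a ^ 2) (pow_pos hb0 2) (pow_lt_one₀ hb0.le hb1 two_ne_zero)).congr fun n ↦ ?_)
  rw [← prod_mul_distrib]
  refine prod_congr rfl fun k _ ↦ ?_
  ring

end qPoch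

section JacobiTripleProduct

/-- The reciprocal of `(b; b)_m`, extended by zero to negative `m`. -/
noncomputable def recipPoch (b : ℝ) : ℤ → ℝ
  | .ofNat n => (∏ i ∈ range n, (1 - b * b ^ i))⁻¹
  | .negSucc _ => 0

variable {b : ℝ}

lemma prod_one_sub_pos (hb0 : 0 < b) (hb1 : b < 1) (n : ℕ) :
    0 < ∏ i ∈ range n, (1 - b * b ^ i) := by
  refine prod_pos fun i _ ↦ ?_
  rw [← pow_succ']
  exact sub_pos.2 (pow_lt_one₀ hb0.le hb1 (Nat.succ_ne_zero i))

lemma prod_one_sub_antitone (hb0 : 0 < b) (hb1 : b < 1) :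
    Antitone fun n : ℕ ↦ ∏ i ∈ range n, (1 - b * b ^ i) := by
  refine antitone_nat_of_succ_le fun n ↦ ?_
  rw [prod_range_succ]
  refine mul_le_of_le_one_right (prod_one_sub_pos hb0 hb1 n).le ?_
  have : 0 < b * b ^ n := by positivity
  linarith

lemma qPoch_self_pos (hb0 : 0 < b) (hb1 : b < 1) : 0 < qPoch b b := by
  refine lt_of_le_of_ne (ge_of_tendsto' (tendsto_qPoch b hb0 hb1)
    fun n ↦ (prod_one_sub_pos hb0 hb1 n).le) (qPoch_ne_zero hb0 hb1 ?_).symm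
  rwa [abs_of_pos hb0]

lemma recipPoch_sub_one (hb0 : 0 < b) (hb1 : b < 1) (m : ℤ) :
    recipPoch b (m - 1) = (1 - b ^ m) * recipPoch b m := by
  rcases m with (_ | n) | n
  · change recipPoch b (.negSucc 0) = _
    simp [recipPoch]
  · have h : (Int.ofNat (n + 1) - 1) = Int.ofNat n := by simp
    have h1 := (prod_one_sub_pos hb0 hb1 n).ne'
    have h2 := (prod_one_sub_pos hb0 hb1 (n + 1)).ne'
    have h3 : b ^ (Int.ofNat (n + 1)) = b * b ^ n := by
      rw [Int.ofNat_eq_natCast, zpow_natCast, pow_succ']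
    rw [h, h3]
    simp only [recipPoch]
    rw [prod_range_succ] at h2 ⊢
    field_simp [right_ne_zero_of_mul h2]
  · have h : Int.negSucc n - 1 = Int.negSucc (n + 1) := by omega
    rw [h]
    simp [recipPoch]

lemma recipPoch_nonneg (hb0 : 0 < b) (hb1 : b < 1) (m : ℤ) : 0 ≤ recipPoch b m := by
  rcases m with n | n
  · exact inv_nonneg.2 (prod_one_sub_pos hb0 hb1 n).le
  · exact le_rfl

lemma recipPoch_le (hb0 : 0 < b) (hb1 : b < 1) (m : ℤ) : recipPoch b m ≤ (qPoch b b)⁻¹ := by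
  have h0 := qPoch_self_pos hb0 hb1
  rcases m with n | n
  · exact inv_anti₀ h0
      ((prod_one_sub_antitone hb0 hb1).le_of_tendsto (tendsto_qPoch b hb0 hb1) n)
  · exact (inv_pos.2 h0).le

lemma tendsto_recipPoch (hb0 : 0 < b) (hb1 : b < 1) :
    Tendsto (recipPoch b) atTop (𝓝 (qPoch b b)⁻¹) := by
  rw [← Nat.map_cast_int_atTop, tendsto_map'_iff]
  exact (tendsto_qPoch b hb0 hb1).inv₀ (qPoch_self_pos hb0 hb1).ne'

/-- The finite form of the Jacobi triple product. -/
lemma hasSum_finite_jacobi {q z : ℝ} (hq0 : 0 < q) (hq1 : q < 1) (hz : z ≠ 0) (n : ℕ) :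
    HasSum (fun j : ℤ ↦ (∏ i ∈ range (2 * n), (1 - q ^ 2 * (q ^ 2) ^ i)) *
        (recipPoch (q ^ 2) (n - j) * recipPoch (q ^ 2) (n + j)) * (z ^ j * q ^ (j ^ 2)))
      ((∏ k ∈ range n, (1 - -(z * q) * (q ^ 2) ^ k)) *
        ∏ k ∈ range n, (1 - -(z⁻¹ * q) * (q ^ 2) ^ k)) := by
  have hb0 : 0 < q ^ 2 := by positivity
  have hb1 : q ^ 2 < 1 := pow_lt_one₀ hq0.le hq1 two_ne_zero
  induction n with
  | zero =>
    have h : ∀ j : ℤ, j ≠ 0 → recipPoch (q ^ 2) (-j) * recipPoch (q ^ 2) j = 0 := by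
      rintro ((_ | j) | j) hj
      · exact absurd rfl hj
      · exact mul_eq_zero_of_left rfl _
      · exact mul_eq_zero_of_right _ rfl
    have h0 : recipPoch (q ^ 2) 0 = 1 := by
      change (∏ i ∈ range 0, (1 - q ^ 2 * (q ^ 2) ^ i))⁻¹ = 1
      simp
    have H := hasSum_single (f := fun j : ℤ ↦
      recipPoch (q ^ 2) (-j) * recipPoch (q ^ 2) j * (z ^ j * q ^ (j ^ 2))) 0
      fun j hj ↦ by rw [h j hj, zero_mul]
    simpa only [neg_zero, h0, zpow_zero, zero_pow two_ne_zero, mul_one, mul_zero, range_zero,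
      prod_empty, Nat.cast_zero, zero_sub, zero_add, one_mul] using H
  | succ n ih =>
    have hL := (Equiv.subRight (1 : ℤ)).hasSum_iff.2 ih
    have hR := (Equiv.addRight (1 : ℤ)).hasSum_iff.2 ih
    have H := ((ih.mul_left (1 + q ^ (4 * n + 2))).add (hL.mul_left (z * q ^ (2 * n + 1)))).add
      (hR.mul_left (z⁻¹ * q ^ (2 * n + 1)))
    have hval : (∏ k ∈ range (n + 1), (1 - -(z * q) * (q ^ 2) ^ k)) *
        ∏ k ∈ range (n + 1), (1 - -(z⁻¹ * q) * (q ^ 2) ^ k) =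
        (1 + q ^ (4 * n + 2) + z * q ^ (2 * n + 1) + z⁻¹ * q ^ (2 * n + 1)) *
        ((∏ k ∈ range n, (1 - -(z * q) * (q ^ 2) ^ k)) *
          ∏ k ∈ range n, (1 - -(z⁻¹ * q) * (q ^ 2) ^ k)) := by
      rw [prod_range_succ, prod_range_succ, mul_mul_mul_comm, mul_comm]
      congr 1
      field_simp
      ring
    rw [hval, add_mul, add_mul]
    refine H.congr_fun fun j ↦ ?_
    simp only [Function.comp_apply, Equiv.subRight_apply, Equiv.coe_addRight, Nat.cast_add,
      Nat.cast_one]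
    have e1 := recipPoch_sub_one hb0 hb1 (n + 1 - j)
    have e2 := recipPoch_sub_one hb0 hb1 (n + 1 + j)
    have e3 := recipPoch_sub_one hb0 hb1 (n - j)
    have e4 := recipPoch_sub_one hb0 hb1 (n + j)
    rw [show (n + 1 - j - 1 : ℤ) = n - j by ring] at e1
    rw [show (n + 1 + j - 1 : ℤ) = n + j by ring] at e2
    rw [show (n - (j + 1) : ℤ) = n - j - 1 by ring, show (n + (j - 1) : ℤ) = n + j - 1 by ring,
      show (n - (j - 1) : ℤ) = n + 1 - j by ring, show (n + (j + 1) : ℤ) = n + 1 + j by ring,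
      e3, e4, e1, e2, show 2 * (n + 1) = 2 * n + 1 + 1 by ring, prod_range_succ, prod_range_succ]
    have hq := hq0.ne'
    have z1 : z ^ (j - 1) = z ^ j * z⁻¹ := by rw [zpow_sub₀ hz, zpow_one, div_eq_mul_inv]
    have z2 : z ^ (j + 1) = z ^ j * z := by rw [zpow_add₀ hz, zpow_one]
    have q1 : q ^ ((j - 1) ^ 2) = q ^ (j ^ 2) * (q ^ j)⁻¹ ^ 2 * q := by
      rw [show (j - 1) ^ 2 = j ^ 2 - j - j + 1 by ring, zpow_add₀ hq, zpow_sub₀ hq, zpow_sub₀ hq,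
        zpow_one]
      field_simp
    have q2 : q ^ ((j + 1) ^ 2) = q ^ (j ^ 2) * (q ^ j) ^ 2 * q := by
      rw [show (j + 1) ^ 2 = j ^ 2 + j + j + 1 by ring, zpow_add₀ hq, zpow_add₀ hq, zpow_add₀ hq,
        zpow_one]
      ring
    have u1 : (q ^ 2) ^ (n + 1 - j : ℤ) = (q ^ n) ^ 2 * q ^ 2 * (q ^ j)⁻¹ ^ 2 := by
      rw [zpow_sub₀ hb0.ne', zpow_add₀ hb0.ne', zpow_natCast, zpow_one, ← zpow_natCast q 2,
        zpow_comm q _ j, zpow_natCast, zpow_natCast]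
      field_simp
      ring
    have u2 : (q ^ 2) ^ (n + 1 + j : ℤ) = (q ^ n) ^ 2 * q ^ 2 * (q ^ j) ^ 2 := by
      rw [zpow_add₀ hb0.ne', zpow_add₀ hb0.ne', zpow_natCast, zpow_one, ← zpow_natCast q 2,
        zpow_comm q _ j, zpow_natCast, zpow_natCast]
      ring
    have u3 : (q ^ 2) ^ (n - j : ℤ) = (q ^ n) ^ 2 * (q ^ j)⁻¹ ^ 2 := by
      rw [zpow_sub₀ hb0.ne', zpow_natCast, ← zpow_natCast q 2,
        zpow_comm q _ j, zpow_natCast, zpow_natCast]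
      field_simp
      ring
    have u4 : (q ^ 2) ^ (n + j : ℤ) = (q ^ n) ^ 2 * (q ^ j) ^ 2 := by
      rw [zpow_add₀ hb0.ne', zpow_natCast, ← zpow_natCast q 2,
        zpow_comm q _ j, zpow_natCast, zpow_natCast]
      ring
    rw [z1, z2, q1, q2, u1, u2, u3, u4]
    have hJ : q ^ j ≠ 0 := zpow_ne_zero _ hq
    field_simp
    ring

lemma summable_theta {q z : ℝ} (hq0 : 0 < q) (hq1 : q < 1) (hz : z ≠ 0) :
    Summable fun j : ℤ ↦ z ^ j * q ^ (j ^ 2) := by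
  have key : ∀ w : ℝ, w ≠ 0 → Summable fun n : ℕ ↦ w ^ n * q ^ (n ^ 2) := by
    intro w hw
    refine summable_of_ratio_test_tendsto_lt_one (l := 0) zero_lt_one
      (Eventually.of_forall fun n ↦ by positivity) ?_
    have h : Tendsto (fun n : ℕ ↦ |w| * q * (q ^ 2) ^ n) atTop (𝓝 (|w| * q * 0)) :=
      (tendsto_pow_atTop_nhds_zero_of_lt_one (by positivity)
        (pow_lt_one₀ hq0.le hq1 two_ne_zero)).const_mul _
    rw [mul_zero] at h
    refine h.congr fun n ↦ ?_
    have hw' : |w| ≠ 0 := abs_ne_zero.2 hw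
    simp only [norm_mul, norm_pow, Real.norm_eq_abs, abs_of_pos hq0]
    field_simp
    ring
  refine Summable.of_nat_of_neg ((key z hz).congr fun n ↦ ?_)
    ((key z⁻¹ (inv_ne_zero hz)).congr fun n ↦ ?_)
  · rw [zpow_natCast]; norm_cast
  · rw [zpow_neg, neg_sq, zpow_natCast, inv_pow]; norm_cast

/-- The Jacobi triple product identity. -/
theorem jacobi_triple_product {q z : ℝ} (hq0 : 0 < q) (hq1 : q < 1) (hz : z ≠ 0) :
    ∑' j : ℤ, z ^ j * q ^ (j ^ 2) =
      qPoch (q ^ 2) (q ^ 2) * qPoch (-(z * q)) (q ^ 2) * qPoch (-(z⁻¹ * q)) (q ^ 2) := by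
  have hb0 : 0 < q ^ 2 := by positivity
  have hb1 : q ^ 2 < 1 := pow_lt_one₀ hq0.le hq1 two_ne_zero
  have hE := qPoch_self_pos hb0 hb1
  set E := qPoch (q ^ 2) (q ^ 2) with hE_def
  have hsum := (summable_theta hq0 hq1 hz).norm
  have hlim := tendsto_tsum_of_dominated_convergence (𝓕 := atTop)
    (f := fun (n : ℕ) (j : ℤ) ↦ (∏ i ∈ range (2 * n), (1 - q ^ 2 * (q ^ 2) ^ i)) *
        (recipPoch (q ^ 2) (n - j) * recipPoch (q ^ 2) (n + j)) * (z ^ j * q ^ (j ^ 2)))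
    (g := fun j : ℤ ↦ E * (E⁻¹ * E⁻¹) * (z ^ j * q ^ (j ^ 2)))
    (hsum.mul_left (1 * (E⁻¹ * E⁻¹))) (fun j ↦ ?_) (Eventually.of_forall fun n j ↦ ?_)
  · simp only [(hasSum_finite_jacobi hq0 hq1 hz _).tsum_eq, tsum_mul_left] at hlim
    have h := tendsto_nhds_unique hlim
      ((tendsto_qPoch (-(z * q)) hb0 hb1).mul (tendsto_qPoch (-(z⁻¹ * q)) hb0 hb1))
    rw [mul_assoc E, ← h]
    field_simp
  · refine Tendsto.mul_const _ (Tendsto.mul ?_ (Tendsto.mul ?_ ?_))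
    · exact (tendsto_qPoch _ hb0 hb1).comp (tendsto_id.const_mul_atTop' two_pos)
    · exact (tendsto_recipPoch hb0 hb1).comp
        (tendsto_atTop_add_const_right _ (-j) tendsto_natCast_atTop_atTop)
    · exact (tendsto_recipPoch hb0 hb1).comp
        (tendsto_atTop_add_const_right _ j tendsto_natCast_atTop_atTop)
  · rw [norm_mul]
    refine mul_le_mul_of_nonneg_right ?_ (norm_nonneg _)
    have h1 := prod_one_sub_pos hb0 hb1 (2 * n)
    have h2 := prod_one_sub_antitone hb0 hb1 (Nat.zero_le (2 * n))
    have h3 := recipPoch_nonneg hb0 hb1 (n - j)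
    have h4 := recipPoch_nonneg hb0 hb1 (n + j)
    rw [Real.norm_of_nonneg (by positivity)]
    have h5 := recipPoch_le hb0 hb1 (n - j)
    have h6 := recipPoch_le hb0 hb1 (n + j)
    simp only [range_zero, prod_empty] at h2
    gcongr

end JacobiTripleProduct

section QuintupleProduct

lemma tsum_int_eq_sum_residues {f : ℤ → ℝ} (hf : Summable f) (N : ℕ) [NeZero N] :
    ∑' n, f n = ∑ r : Fin N, ∑' m : ℤ, f (m * N + (r : ℕ)) := by
  have h := (Int.divModEquiv N).symm.summable_iff.2 hf
  rw [← (Int.divModEquiv N).symm.tsum_eq, ← (Equiv.prodComm _ _).tsum_eq]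
  rw [← (Equiv.prodComm _ _).summable_iff] at h
  refine (Summable.tsum_prod h).trans ?_
  rw [tsum_fintype]
  rfl

lemma tsum_neg_one_zpow_mul_six_eq_zero (q : ℝ) :
    ∑' l : ℤ, (-1 : ℝ) ^ l * q ^ (6 * l ^ 2 - 6 * l) = 0 := by
  have h : ∑' l : ℤ, (-1 : ℝ) ^ l * q ^ (6 * l ^ 2 - 6 * l) =
      ∑' l : ℤ, -((-1 : ℝ) ^ l * q ^ (6 * l ^ 2 - 6 * l)) := by
    rw [← (Equiv.subLeft (1 : ℤ)).tsum_eq]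
    refine tsum_congr fun l ↦ ?_
    rw [Equiv.subLeft_apply, zpow_sub₀ (by norm_num), zpow_one,
      show 6 * (1 - l) ^ 2 - 6 * (1 - l) = 6 * l ^ 2 - 6 * l by ring, div_eq_mul_inv, ← inv_zpow,
      inv_neg_one]
    ring
  rw [tsum_neg] at h
  linarith

variable {q w : ℝ}

lemma summable_alternating_theta (hq0 : 0 < q) (hq1 : q < 1) (hw : w ≠ 0) :
    Summable fun j : ℤ ↦ (-1 : ℝ) ^ j * w ^ (2 * j) * q ^ (2 * j ^ 2 - 2 * j) := by
  have hz : -(w ^ 2 * q⁻¹ ^ 2) ≠ 0 :=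
    neg_ne_zero.2 (mul_ne_zero (pow_ne_zero _ hw) (pow_ne_zero _ (inv_ne_zero hq0.ne')))
  refine (summable_theta (pow_pos hq0 2) (pow_lt_one₀ hq0.le hq1 two_ne_zero) hz).congr
    fun j ↦ ?_
  rw [neg_eq_neg_one_mul, mul_zpow, mul_zpow, ← zpow_natCast w, ← zpow_natCast q,
    ← zpow_natCast q⁻¹, ← zpow_mul, ← zpow_mul, ← zpow_mul, inv_zpow', sub_eq_add_neg,
    zpow_add₀ hq0.ne']
  push_cast
  ring_nf

/-- The quintuple product identity, with the products written as theta series. -/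
theorem quintuple_product (hq0 : 0 < q) (hq1 : q < 1) (hw : w ≠ 0) :
    (∑' i : ℤ, w ^ i * q ^ (i ^ 2)) *
        ∑' j : ℤ, (-1 : ℝ) ^ j * w ^ (2 * j) * q ^ (2 * j ^ 2 - 2 * j) =
      (∑' l : ℤ, (-1 : ℝ) ^ l * q ^ (6 * l ^ 2 - 2 * l)) *
        ((∑' m : ℤ, (-1 : ℝ) ^ m * w ^ (3 * m) * q ^ (3 * m ^ 2 - 2 * m)) +
          ∑' m : ℤ, (-1 : ℝ) ^ m * w ^ (3 * m - 1) * q ^ (3 * m ^ 2 - 4 * m + 1)) := by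
  have hq := hq0.ne'
  have h1 : (-1 : ℝ) ≠ 0 := by norm_num
  let e : ℤ × ℤ ≃ ℤ × ℤ :=
    { toFun := fun p ↦ (p.1 - 2 * p.2, p.2)
      invFun := fun p ↦ (p.1 + 2 * p.2, p.2)
      left_inv := fun p ↦ by simp
      right_inv := fun p ↦ by simp }
  let h : ℤ → ℤ → ℝ := fun n j ↦
    (-1 : ℝ) ^ j * w ^ n * q ^ (n ^ 2 - 4 * n * j + 6 * j ^ 2 - 2 * j)
  have hf := (summable_theta hq0 hq1 hw).norm
  have hg := (summable_alternating_theta hq0 hq1 hw).norm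
  have hfg : ∀ p : ℤ × ℤ, w ^ (e p).1 * q ^ ((e p).1 ^ 2) *
      ((-1 : ℝ) ^ (e p).2 * w ^ (2 * (e p).2) * q ^ (2 * (e p).2 ^ 2 - 2 * (e p).2)) =
      h p.1 p.2 := by
    rintro ⟨n, j⟩
    change w ^ (n - 2 * j) * q ^ ((n - 2 * j) ^ 2) *
      ((-1 : ℝ) ^ j * w ^ (2 * j) * q ^ (2 * j ^ 2 - 2 * j)) =
      (-1 : ℝ) ^ j * w ^ n * q ^ (n ^ 2 - 4 * n * j + 6 * j ^ 2 - 2 * j)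
    rw [show w ^ n = w ^ (n - 2 * j) * w ^ (2 * j) by rw [← zpow_add₀ hw]; ring_nf,
      show n ^ 2 - 4 * n * j + 6 * j ^ 2 - 2 * j = (n - 2 * j) ^ 2 + (2 * j ^ 2 - 2 * j) by ring,
      zpow_add₀ hq]
    ring
  have hsum : Summable fun p : ℤ × ℤ ↦ h p.1 p.2 :=
    (e.summable_iff.2 (summable_mul_of_summable_norm hf hg)).congr hfg
  rw [tsum_mul_tsum_of_summable_norm hf hg, ← e.tsum_eq, tsum_congr hfg,
    hsum.tsum_prod, tsum_int_eq_sum_residues hsum.prod 3, Fin.sum_univ_three]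
  have r0 : ∀ m : ℤ, ∑' j, h (m * 3) j = (-1 : ℝ) ^ m * w ^ (3 * m) * q ^ (3 * m ^ 2 - 2 * m) *
      ∑' l : ℤ, (-1 : ℝ) ^ l * q ^ (6 * l ^ 2 - 2 * l) := by
    intro m
    rw [← (Equiv.addRight m).tsum_eq, ← tsum_mul_left]
    refine tsum_congr fun l ↦ ?_
    simp only [h, Equiv.coe_addRight]
    rw [show (m * 3) ^ 2 - 4 * (m * 3) * (l + m) + 6 * (l + m) ^ 2 - 2 * (l + m) =
      (3 * m ^ 2 - 2 * m) + (6 * l ^ 2 - 2 * l) by ring, zpow_add₀ hq, zpow_add₀ h1, mul_comm m 3]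
    ring
  have r1 : ∀ m : ℤ, ∑' j, h (m * 3 + 1) j = 0 := by
    intro m
    rw [← mul_zero ((-1 : ℝ) ^ m * w ^ (m * 3 + 1) * q ^ (3 * m ^ 2 + 1)),
      ← tsum_neg_one_zpow_mul_six_eq_zero q, ← (Equiv.addRight m).tsum_eq, ← tsum_mul_left]
    refine tsum_congr fun l ↦ ?_
    simp only [h, Equiv.coe_addRight]
    rw [show (m * 3 + 1) ^ 2 - 4 * (m * 3 + 1) * (l + m) + 6 * (l + m) ^ 2 - 2 * (l + m) =
      (3 * m ^ 2 + 1) + (6 * l ^ 2 - 6 * l) by ring, zpow_add₀ hq, zpow_add₀ h1]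
    ring
  have r2 : ∀ m : ℤ, ∑' j, h (m * 3 + 2) j =
      (-1 : ℝ) ^ (m + 1) * w ^ (3 * (m + 1) - 1) * q ^ (3 * (m + 1) ^ 2 - 4 * (m + 1) + 1) *
      ∑' l : ℤ, (-1 : ℝ) ^ l * q ^ (6 * l ^ 2 - 2 * l) := by
    intro m
    rw [← (Equiv.subLeft (m + 1)).tsum_eq, ← tsum_mul_left]
    refine tsum_congr fun l ↦ ?_
    simp only [h, Equiv.subLeft_apply]
    rw [show (m * 3 + 2) ^ 2 - 4 * (m * 3 + 2) * (m + 1 - l) + 6 * (m + 1 - l) ^ 2 -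
      2 * (m + 1 - l) = (3 * (m + 1) ^ 2 - 4 * (m + 1) + 1) + (6 * l ^ 2 - 2 * l) by ring,
      zpow_add₀ hq, show m * 3 + 2 = 3 * (m + 1) - 1 by ring, zpow_sub₀ h1 (m + 1) l,
      div_eq_mul_inv, ← inv_zpow, inv_neg_one]
    ring
  simp only [Fin.val_zero, Fin.val_one, Fin.val_two, Nat.cast_zero, Nat.cast_one, Nat.cast_ofNat,
    add_zero, r0, r1, r2, tsum_zero, tsum_mul_right]
  have hshift := (Equiv.addRight (1 : ℤ)).tsum_eq
    fun m : ℤ ↦ (-1 : ℝ) ^ m * w ^ (3 * m - 1) * q ^ (3 * m ^ 2 - 4 * m + 1)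
  simp only [Equiv.coe_addRight] at hshift
  rw [hshift]
  ring

end QuintupleProduct

section ThetaSeries

variable {x y : ℝ}

lemma summable_zpow_quadratic (hx0 : 0 < x) (hx1 : x < 1) {a : ℤ} (ha : 0 < a) (b c : ℤ) :
    Summable fun k : ℤ ↦ x ^ (a * k ^ 2 + b * k + c) := by
  lift a to ℕ using ha.le
  have ha' : a ≠ 0 := by rintro rfl; exact lt_irrefl _ ha
  refine ((summable_theta (pow_pos hx0 a) (pow_lt_one₀ hx0.le hx1 ha')
    (zpow_ne_zero b hx0.ne')).mul_left (x ^ c)).congr fun k ↦ ?_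
  rw [zpow_add₀ hx0.ne', zpow_add₀ hx0.ne', zpow_mul, zpow_mul, zpow_natCast]
  ring

lemma tsum_neg_one_zpow_mul {f : ℤ → ℝ} (hf : Summable f) :
    ∑' m : ℤ, (-1 : ℝ) ^ m * f m = ∑' k : ℤ, f (2 * k) - ∑' k : ℤ, f (2 * k + 1) := by
  have hf' : Summable fun m : ℤ ↦ (-1 : ℝ) ^ m * f m := by
    refine hf.norm.of_norm_bounded fun m ↦ ?_
    simp
  rw [tsum_int_eq_sum_residues hf' 2, Fin.sum_univ_two, sub_eq_add_neg, ← tsum_neg]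
  have h1 : (-1 : ℝ) ≠ 0 := by norm_num
  congr 1 <;> refine tsum_congr fun k ↦ ?_
  · simp [mul_comm k, zpow_mul]
  · simp [mul_comm k, zpow_mul, zpow_add₀ h1]

lemma tsum_one_theta (hx0 : 0 < x) (hx1 : x < 1) :
    ∑' i : ℤ, (x ^ 2) ^ i * (x ^ 5) ^ (i ^ 2) =
      qPoch (x ^ 10) (x ^ 10) * qPoch (-x ^ 7) (x ^ 10) * qPoch (-x ^ 3) (x ^ 10) := by
  rw [jacobi_triple_product (pow_pos hx0 5) (pow_lt_one₀ hx0.le hx1 (by norm_num))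
    (pow_ne_zero 2 hx0.ne'), ← pow_mul, ← pow_add,
    show (x ^ 2)⁻¹ * x ^ 5 = x ^ 3 by field_simp]

lemma tsum_alternating_theta (hx0 : 0 < x) (hx1 : x < 1) :
    ∑' j : ℤ, (-1 : ℝ) ^ j * (x ^ 2) ^ (2 * j) * (x ^ 5) ^ (2 * j ^ 2 - 2 * j) =
      qPoch (x ^ 20) (x ^ 20) * qPoch (x ^ 4) (x ^ 20) * qPoch (x ^ 16) (x ^ 20) := by
  have hz : -(x ^ 6)⁻¹ ≠ 0 := neg_ne_zero.2 (inv_ne_zero (pow_ne_zero 6 hx0.ne'))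
  have h := jacobi_triple_product (pow_pos hx0 10) (pow_lt_one₀ hx0.le hx1 (by norm_num)) hz
  rw [← pow_mul, show -(-(x ^ 6)⁻¹ * x ^ 10) = x ^ 4 by field_simp,
    show -((-(x ^ 6)⁻¹)⁻¹ * x ^ 10) = x ^ 16 by field_simp] at h
  rw [← h]
  refine tsum_congr fun j ↦ ?_
  rw [neg_eq_neg_one_mul (x ^ 6)⁻¹, mul_zpow, mul_assoc, mul_assoc, inv_zpow']
  simp only [← zpow_natCast x, ← zpow_mul, ← zpow_add₀ hx0.ne']
  push_cast
  ring_nf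

lemma tsum_pentagonal (hx0 : 0 < x) (hx1 : x < 1) :
    ∑' l : ℤ, (-1 : ℝ) ^ l * (x ^ 5) ^ (6 * l ^ 2 - 2 * l) = qPoch (x ^ 20) (x ^ 20) := by
  have hz : -(x ^ 10)⁻¹ ≠ 0 := neg_ne_zero.2 (inv_ne_zero (pow_ne_zero 10 hx0.ne'))
  have h := jacobi_triple_product (pow_pos hx0 30) (pow_lt_one₀ hx0.le hx1 (by norm_num)) hz
  rw [← pow_mul, show -(-(x ^ 10)⁻¹ * x ^ 30) = x ^ 20 by field_simp,
    show -((-(x ^ 10)⁻¹)⁻¹ * x ^ 30) = x ^ 40 by field_simp] at h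
  rw [qPoch_eq_prod_range (x ^ 20) (pow_pos hx0 20) (pow_lt_one₀ hx0.le hx1 (by norm_num))
    three_ne_zero]
  simp only [prod_range_succ, prod_range_zero, ← pow_mul, ← pow_add]
  norm_num only [one_mul]
  rw [mul_comm, ← mul_assoc]
  refine Eq.trans (tsum_congr fun j ↦ ?_) h
  rw [neg_eq_neg_one_mul (x ^ 10)⁻¹, mul_zpow, mul_assoc, inv_zpow']
  simp only [← zpow_natCast x, ← zpow_mul, ← zpow_add₀ hx0.ne']
  push_cast
  ring_nf

lemma tsum_rogers_ramanujan (hy0 : 0 < y) (hy1 : y < 1) :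
    ∑' m : ℤ, (-1 : ℝ) ^ m * y ^ (5 * m ^ 2 - 3 * m) =
      qPoch (y ^ 10) (y ^ 10) * qPoch (y ^ 2) (y ^ 10) * qPoch (y ^ 8) (y ^ 10) := by
  have hz : -(y ^ 3)⁻¹ ≠ 0 := neg_ne_zero.2 (inv_ne_zero (pow_ne_zero 3 hy0.ne'))
  have h := jacobi_triple_product (pow_pos hy0 5) (pow_lt_one₀ hy0.le hy1 (by norm_num)) hz
  rw [← pow_mul, show -(-(y ^ 3)⁻¹ * y ^ 5) = y ^ 2 by field_simp,
    show -((-(y ^ 3)⁻¹)⁻¹ * y ^ 5) = y ^ 8 by field_simp] at h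
  refine Eq.trans (tsum_congr fun j ↦ ?_) h
  rw [neg_eq_neg_one_mul (y ^ 3)⁻¹, mul_zpow, mul_assoc, inv_zpow']
  simp only [← zpow_natCast y, ← zpow_mul, ← zpow_add₀ hy0.ne']
  push_cast
  ring_nf

/-- The numerators of the `(5, 6)` characters sum to a quintuple product. -/
lemma tsum_add_tsum_eq_quintuple (hx0 : 0 < x) (hx1 : x < 1) :
    (∑' m : ℤ, (-1 : ℝ) ^ m * x ^ (15 * m ^ 2 - 4 * m)) +
        ∑' m : ℤ, (-1 : ℝ) ^ m * x ^ (15 * m ^ 2 - 14 * m + 3) =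
      qPoch (x ^ 10) (x ^ 10) * qPoch (-x ^ 7) (x ^ 10) * qPoch (-x ^ 3) (x ^ 10) *
        (qPoch (x ^ 4) (x ^ 20) * qPoch (x ^ 16) (x ^ 20)) := by
  have hE := (qPoch_self_pos (pow_pos hx0 20) (pow_lt_one₀ hx0.le hx1 (by norm_num))).ne'
  have h := quintuple_product (pow_pos hx0 5) (pow_lt_one₀ hx0.le hx1 (by norm_num))
    (pow_ne_zero 2 hx0.ne')
  rw [tsum_one_theta hx0 hx1, tsum_alternating_theta hx0 hx1, tsum_pentagonal hx0 hx1] at h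
  have e1 : ∀ m : ℤ, (-1 : ℝ) ^ m * (x ^ 2) ^ (3 * m) * (x ^ 5) ^ (3 * m ^ 2 - 2 * m) =
      (-1 : ℝ) ^ m * x ^ (15 * m ^ 2 - 4 * m) := by
    intro m
    rw [mul_assoc]
    simp only [← zpow_natCast x, ← zpow_mul, ← zpow_add₀ hx0.ne']
    push_cast
    ring_nf
  have e2 : ∀ m : ℤ, (-1 : ℝ) ^ m * (x ^ 2) ^ (3 * m - 1) * (x ^ 5) ^ (3 * m ^ 2 - 4 * m + 1) =
      (-1 : ℝ) ^ m * x ^ (15 * m ^ 2 - 14 * m + 3) := by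
    intro m
    rw [mul_assoc]
    simp only [← zpow_natCast x, ← zpow_mul, ← zpow_add₀ hx0.ne']
    push_cast
    ring_nf
  simp only [e1, e2] at h
  refine mul_left_cancel₀ hE ?_
  linear_combination -h

lemma theta_five_six_mul_qPoch (hx0 : 0 < x) (hx1 : x < 1) :
    ((∑' m : ℤ, (-1 : ℝ) ^ m * x ^ (15 * m ^ 2 - 4 * m)) +
        ∑' m : ℤ, (-1 : ℝ) ^ m * x ^ (15 * m ^ 2 - 14 * m + 3)) * qPoch x (x ^ 2) =
      qPoch (x ^ 5) (x ^ 5) * qPoch x (x ^ 5) * qPoch (x ^ 4) (x ^ 5) := by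
  have hlt : ∀ {n : ℕ}, n ≠ 0 → x ^ n < 1 := fun hn ↦ pow_lt_one₀ hx0.le hx1 hn
  have d2 : qPoch x (x ^ 2) = qPoch x (x ^ 10) * qPoch (x ^ 3) (x ^ 10) * qPoch (x ^ 5) (x ^ 10) *
      qPoch (x ^ 7) (x ^ 10) * qPoch (x ^ 9) (x ^ 10) := by
    rw [qPoch_eq_prod_range x (pow_pos hx0 2) (hlt two_ne_zero) (N := 5) (by norm_num)]
    simp only [prod_range_succ, prod_range_zero, ← pow_mul, ← pow_succ']
    norm_num
  have d5 : ∀ a : ℝ, qPoch a (x ^ 5) = qPoch a (x ^ 10) * qPoch (a * x ^ 5) (x ^ 10) := by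
    intro a
    rw [qPoch_eq_prod_range a (pow_pos hx0 5) (hlt (by norm_num)) two_ne_zero]
    simp [prod_range_succ, ← pow_mul]
  have d10 : ∀ a : ℝ, qPoch a (x ^ 10) = qPoch a (x ^ 20) * qPoch (a * x ^ 10) (x ^ 20) := by
    intro a
    rw [qPoch_eq_prod_range a (pow_pos hx0 10) (hlt (by norm_num)) two_ne_zero]
    simp [prod_range_succ, ← pow_mul]
  have n3 := qPoch_mul_qPoch_neg (x ^ 3) (pow_pos hx0 10) (hlt (by norm_num))
  have n7 := qPoch_mul_qPoch_neg (x ^ 7) (pow_pos hx0 10) (hlt (by norm_num))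
  have s4 := d10 (x ^ 4)
  have s6 := d10 (x ^ 6)
  rw [tsum_add_tsum_eq_quintuple hx0 hx1, d2, d5, d5, d5, ← pow_add, ← pow_add, ← pow_succ']
  simp only [← pow_mul, ← pow_add, Nat.reduceAdd, Nat.reduceMul] at n3 n7 s4 s6 ⊢
  rw [s4, s6, ← n3, ← n7]
  ring

end ThetaSeries

lemma eulerProd_eq_qPoch (q : ℝ) : eulerProd q = qPoch q q := by
  simp only [eulerProd, qPoch, pow_succ']

lemma tsum_char_five_six {x : ℝ} (hx0 : 0 < x) (hx1 : x < 1) :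
    (∑' k : ℤ, ((x ^ 2) ^ ((5 : ℤ) * 6 * k ^ 2 + k * (1 * 6 - 2 * 5)) -
        (x ^ 2) ^ ((5 : ℤ) * 6 * k ^ 2 + (1 * 6 + 2 * 5) * k + 1 * 2))) +
      x ^ 3 * ∑' k : ℤ, ((x ^ 2) ^ ((5 : ℤ) * 6 * k ^ 2 + k * (1 * 6 - 4 * 5)) -
        (x ^ 2) ^ ((5 : ℤ) * 6 * k ^ 2 + (1 * 6 + 4 * 5) * k + 1 * 4)) =
    (∑' m : ℤ, (-1 : ℝ) ^ m * x ^ (15 * m ^ 2 - 4 * m)) +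
      ∑' m : ℤ, (-1 : ℝ) ^ m * x ^ (15 * m ^ 2 - 14 * m + 3) := by
  have hs (b c : ℤ) := summable_zpow_quadratic hx0 hx1 (a := 60) (by norm_num) b c
  have h1 := tsum_neg_one_zpow_mul
    (summable_zpow_quadratic hx0 hx1 (a := 15) (by norm_num) (-4) 0)
  have h2 := tsum_neg_one_zpow_mul
    (summable_zpow_quadratic hx0 hx1 (a := 15) (by norm_num) (-14) 3)
  have c1 : ∑' k : ℤ, ((x ^ 2) ^ ((5 : ℤ) * 6 * k ^ 2 + k * (1 * 6 - 2 * 5)) -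
      (x ^ 2) ^ ((5 : ℤ) * 6 * k ^ 2 + (1 * 6 + 2 * 5) * k + 1 * 2)) =
      ∑' k : ℤ, x ^ (60 * k ^ 2 + -8 * k + 0) - ∑' k : ℤ, x ^ (60 * k ^ 2 + 32 * k + 4) := by
    rw [← (hs _ _).tsum_sub (hs _ _)]
    refine tsum_congr fun k ↦ ?_
    simp only [← zpow_natCast x, ← zpow_mul]
    push_cast
    ring_nf
  have c2 : x ^ 3 * ∑' k : ℤ, ((x ^ 2) ^ ((5 : ℤ) * 6 * k ^ 2 + k * (1 * 6 - 4 * 5)) -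
      (x ^ 2) ^ ((5 : ℤ) * 6 * k ^ 2 + (1 * 6 + 4 * 5) * k + 1 * 4)) =
      ∑' k : ℤ, x ^ (60 * k ^ 2 + -28 * k + 3) - ∑' k : ℤ, x ^ (60 * k ^ 2 + 52 * k + 11) := by
    rw [← (hs _ _).tsum_sub (hs _ _), ← tsum_mul_left]
    refine tsum_congr fun k ↦ ?_
    rw [mul_sub]
    simp only [← zpow_natCast x, ← zpow_mul, ← zpow_add₀ hx0.ne']
    push_cast
    ring_nf
  rw [c1, c2]
  ring_nf at h1 h2 ⊢
  rw [h1, h2]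
  ring

lemma tsum_char_two_five {x y : ℝ} (hx0 : 0 < x) (hx1 : x < 1) (hy0 : 0 < y) (hy1 : y < 1)
    (hxy : x = y ^ 2) :
    ∑' k : ℤ, (x ^ ((2 : ℤ) * 5 * k ^ 2 + k * (1 * 5 - 1 * 2)) -
        x ^ ((2 : ℤ) * 5 * k ^ 2 + (1 * 5 + 1 * 2) * k + 1 * 1)) =
      ∑' m : ℤ, (-1 : ℝ) ^ m * y ^ (5 * m ^ 2 - 3 * m) := by
  have hs (b c : ℤ) := summable_zpow_quadratic hx0 hx1 (a := 10) (by norm_num) b c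
  have h1 := tsum_neg_one_zpow_mul
    (summable_zpow_quadratic hy0 hy1 (a := 5) (by norm_num) (-3) 0)
  have c1 : ∑' k : ℤ, (x ^ ((2 : ℤ) * 5 * k ^ 2 + k * (1 * 5 - 1 * 2)) -
      x ^ ((2 : ℤ) * 5 * k ^ 2 + (1 * 5 + 1 * 2) * k + 1 * 1)) =
      ∑' k : ℤ, x ^ (10 * k ^ 2 + 3 * k + 0) - ∑' k : ℤ, x ^ (10 * k ^ 2 + 7 * k + 1) := by
    rw [← (hs _ _).tsum_sub (hs _ _)]
    refine tsum_congr fun k ↦ ?_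
    ring_nf
  rw [c1, ← (Equiv.neg ℤ).tsum_eq fun k : ℤ ↦ x ^ (10 * k ^ 2 + 3 * k + 0)]
  have e1 : ∀ k : ℤ, x ^ (10 * (Equiv.neg ℤ k) ^ 2 + 3 * (Equiv.neg ℤ k) + 0) =
      y ^ (5 * (2 * k) ^ 2 + -3 * (2 * k) + 0) := by
    intro k
    rw [hxy, Equiv.neg_apply, ← zpow_natCast y, ← zpow_mul]
    push_cast
    ring_nf
  have e2 : ∀ k : ℤ, x ^ (10 * k ^ 2 + 7 * k + 1) =
      y ^ (5 * (2 * k + 1) ^ 2 + -3 * (2 * k + 1) + 0) := by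
    intro k
    rw [hxy, ← zpow_natCast y, ← zpow_mul]
    push_cast
    ring_nf
  rw [tsum_congr e1, tsum_congr e2, ← h1]
  ring_nf

theorem chi_5_6_sum_eq_chi_2_5_1_1_sqrt (q : ℝ) (hq0 : 0 < q) (hq1 : q < 1) :
    minChar 5 6 1 2 q + minChar 5 6 1 4 q = minChar 2 5 1 1 (q ^ ((1 : ℝ) / 2)) := by
  obtain ⟨x, hx⟩ : ∃ x, x = q ^ ((1 : ℝ) / 2) := ⟨_, rfl⟩
  obtain ⟨y, hy⟩ : ∃ y, y = √x := ⟨_, rfl⟩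
  have hx0 : 0 < x := hx ▸ Real.rpow_pos_of_pos hq0 _
  have hx1 : x < 1 := hx ▸ Real.rpow_lt_one hq0.le hq1 (by norm_num)
  have hy0 : 0 < y := hy ▸ Real.sqrt_pos.2 hx0
  have hy1 : y < 1 := by rw [hy, Real.sqrt_lt' one_pos]; simpa using hx1
  have hxy : x = y ^ 2 := by rw [hy, Real.sq_sqrt hx0.le]
  have hqx : q = x ^ 2 := by
    rw [hx, ← Real.rpow_natCast, ← Real.rpow_mul hq0.le]
    norm_num
  have p1 : q ^ ((191 : ℝ) / 120) = q ^ ((11 : ℝ) / 120) * x ^ 3 := by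
    rw [hx, ← Real.rpow_natCast, ← Real.rpow_mul hq0.le, ← Real.rpow_add hq0]
    norm_num
  have p2 : x ^ ((11 : ℝ) / 60) = q ^ ((11 : ℝ) / 120) := by
    rw [hx, ← Real.rpow_mul hq0.le]
    norm_num
  have hE : eulerProd x = qPoch x q * eulerProd q := by
    rw [eulerProd_eq_qPoch, eulerProd_eq_qPoch, hqx, qPoch_eq_prod_range x hx0 hx1 two_ne_zero]
    simp [prod_range_succ, ← pow_two]
  have hne : eulerProd x ≠ 0 := by
    rw [eulerProd_eq_qPoch]
    exact (qPoch_self_pos hx0 hx1).ne'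
  rw [hE] at hne
  have hmain := theta_five_six_mul_qPoch hx0 hx1
  have hrr := tsum_rogers_ramanujan hy0 hy1
  rw [show y ^ 10 = x ^ 5 by rw [hxy]; ring, show y ^ 8 = x ^ 4 by rw [hxy]; ring, ← hxy,
    ← hmain, ← tsum_char_five_six hx0 hx1, ← tsum_char_two_five hx0 hx1 hy0 hy1 hxy, ← hqx] at hrr
  rw [← hx]
  simp only [minChar]
  rw [hrr, hE]
  have x1 : (((1 * 6 - 2 * 5) ^ 2 - (5 - 6) ^ 2 : ℤ) : ℝ) / (4 * ((5 : ℤ) : ℝ) * ((6 : ℤ) : ℝ)) -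
      (1 - 6 * (((5 : ℤ) : ℝ) - ((6 : ℤ) : ℝ)) ^ 2 / (((5 : ℤ) : ℝ) * ((6 : ℤ) : ℝ))) / 24 =
      11 / 120 := by norm_num
  have x2 : (((1 * 6 - 4 * 5) ^ 2 - (5 - 6) ^ 2 : ℤ) : ℝ) / (4 * ((5 : ℤ) : ℝ) * ((6 : ℤ) : ℝ)) -
      (1 - 6 * (((5 : ℤ) : ℝ) - ((6 : ℤ) : ℝ)) ^ 2 / (((5 : ℤ) : ℝ) * ((6 : ℤ) : ℝ))) / 24 =
      191 / 120 := by norm_num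
  have x3 : (((1 * 5 - 1 * 2) ^ 2 - (2 - 5) ^ 2 : ℤ) : ℝ) / (4 * ((2 : ℤ) : ℝ) * ((5 : ℤ) : ℝ)) -
      (1 - 6 * (((2 : ℤ) : ℝ) - ((5 : ℤ) : ℝ)) ^ 2 / (((2 : ℤ) : ℝ) * ((5 : ℤ) : ℝ))) / 24 =
      11 / 60 := by norm_num
  rw [x1, x2, x3, p1, p2]
  have h1 := left_ne_zero_of_mul hne
  have h2 := right_ne_zero_of_mul hne
  field_simp
end

section
/- For every real number q with 0 < q < 1, the following identity between minimal model characters of central charges 4/5 and −22/5 holds: χ_{5,6}^{2,2}(q) + χ_{5,6}^{2,4}(q) = χ_{2,5}^{1,2}(q^{1/2}). -/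
open scoped BigOperators

open Filter Topology

/-- The finite `q`-factorial product `(q; q)_n`. -/
noncomputable def qFact (q : ℝ) (n : ℕ) : ℝ := ∏ i ∈ Finset.range n, (1 - q ^ (i + 1))

/-- The reciprocal of `(q; q)_m`, extended by zero to negative `m`. -/
noncomputable def qFactInv (q : ℝ) (m : ℤ) : ℝ := if m < 0 then 0 else (qFact q m.toNat)⁻¹

lemma qFact_succ (q : ℝ) (n : ℕ) : qFact q (n + 1) = qFact q n * (1 - q ^ (n + 1)) :=
  Finset.prod_range_succ _ _

lemma one_sub_pow_pos {q : ℝ} (hq0 : 0 < q) (hq1 : q < 1) {n : ℕ} (hn : n ≠ 0) :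
    0 < 1 - q ^ n :=
  sub_pos.2 (pow_lt_one₀ hq0.le hq1 hn)

lemma qFact_pos {q : ℝ} (hq0 : 0 < q) (hq1 : q < 1) (n : ℕ) : 0 < qFact q n :=
  Finset.prod_pos fun _ _ => one_sub_pow_pos hq0 hq1 (Nat.succ_ne_zero _)

lemma qFactInv_sub_one {q : ℝ} (hq0 : 0 < q) (hq1 : q < 1) (m : ℤ) :
    qFactInv q (m - 1) = (1 - q ^ m) * qFactInv q m := by
  rcases lt_trichotomy m 0 with h | rfl | h
  · simp [qFactInv, h, show m < 1 by omega]
  · simp [qFactInv]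
  · obtain ⟨n, rfl⟩ : ∃ n : ℕ, m = n + 1 := ⟨(m - 1).toNat, by omega⟩
    have h1 := one_sub_pow_pos hq0 hq1 n.succ_ne_zero
    have h2 := qFact_pos hq0 hq1 n
    have h3 : ((n : ℤ) + 1).toNat = n + 1 := by omega
    simp only [qFactInv, add_sub_cancel_right, h3, qFact_succ]
    rw [if_neg (by omega), if_neg (by omega), Int.toNat_natCast]
    have : q ^ ((n : ℤ) + 1) = q ^ (n + 1) := by exact_mod_cast zpow_natCast q (n + 1)
    rw [this]
    simp only [Nat.succ_eq_add_one] at h1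
    field_simp

/-- The finite form of the Jacobi triple product. -/
lemma hasSum_finite_tripleProduct {p w : ℝ} (hp0 : 0 < p) (hp1 : p < 1) (hw : w ≠ 0) (n : ℕ) :
    HasSum (fun k : ℤ => qFact (p ^ 2) (2 * n) * qFactInv (p ^ 2) (n + k) *
        qFactInv (p ^ 2) (n - k) * (p ^ (k ^ 2) * w ^ k))
      (∏ i ∈ Finset.range n, (1 + w * p ^ (2 * i + 1)) * (1 + w⁻¹ * p ^ (2 * i + 1))) := by
  have hq0 : 0 < p ^ 2 := by positivity
  have hq1 : p ^ 2 < 1 := pow_lt_one₀ hp0.le hp1 two_ne_zero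
  induction n with
  | zero =>
    convert hasSum_single (0 : ℤ) ?_ using 1
    · simp [qFact, qFactInv]
    · intro k hk
      rcases lt_or_gt_of_ne hk with h | h <;> simp [qFactInv, h]
  | succ n ih =>
    rw [Finset.prod_range_succ]
    have h1 := (Equiv.subRight (1 : ℤ)).hasSum_iff.2 ih
    have h2 := (Equiv.addRight (1 : ℤ)).hasSum_iff.2 ih
    have h := ((ih.mul_left (1 + p ^ (4 * n + 2))).add (h1.mul_left (p ^ (2 * n + 1) * w))).add
      (h2.mul_left (p ^ (2 * n + 1) * w⁻¹))
    have hprod (P : ℝ) : P * ((1 + w * p ^ (2 * n + 1)) * (1 + w⁻¹ * p ^ (2 * n + 1))) =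
        (1 + p ^ (4 * n + 2)) * P + p ^ (2 * n + 1) * w * P + p ^ (2 * n + 1) * w⁻¹ * P := by
      field_simp
      ring
    rw [hprod]
    refine (congrArg (HasSum · _) (funext fun k => ?_)).mpr h
    clear h h1 h2 ih
    simp only [Function.comp_apply, Equiv.subRight_apply, Equiv.coe_addRight]
    have r1 := qFactInv_sub_one hq0 hq1 (n + 1 + k)
    have r2 := qFactInv_sub_one hq0 hq1 (n + k)
    have r3 := qFactInv_sub_one hq0 hq1 (n + 1 - k)
    have r4 := qFactInv_sub_one hq0 hq1 (n - k)
    rw [show (n : ℤ) + 1 + k - 1 = n + k by ring] at r1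
    rw [show (n : ℤ) + 1 - k - 1 = n - k by ring] at r3
    rw [show ((n + 1 : ℕ) : ℤ) + k = n + 1 + k by push_cast; ring,
      show ((n + 1 : ℕ) : ℤ) - k = n + 1 - k by push_cast; ring,
      show (n : ℤ) + (k - 1) = n + k - 1 by ring, show (n : ℤ) - (k - 1) = n + 1 - k by ring,
      show (n : ℤ) + (k + 1) = n + 1 + k by ring, show (n : ℤ) - (k + 1) = n - k - 1 by ring,
      r2, r4, r1, r3, show 2 * (n + 1) = 2 * n + 1 + 1 by ring, qFact_succ, qFact_succ,
      show (k - 1) ^ 2 = k ^ 2 - 2 * k + 1 by ring, show (k + 1) ^ 2 = k ^ 2 + 2 * k + 1 by ring]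
    have hA (a : ℤ) : (p ^ 2) ^ a = p ^ (2 * a) := by rw [zpow_mul]; norm_cast
    simp only [hA, mul_add, mul_sub, zpow_add₀ hp0.ne', zpow_sub₀ hp0.ne', zpow_add₀ hw,
      zpow_sub₀ hw, ← pow_mul, pow_add, mul_one, zpow_one]
    have e1 : p ^ (2 * (n : ℤ)) = (p ^ n) ^ 2 := by rw [← pow_mul]; norm_cast; ring_nf
    have e2 : p ^ (2 * k) = (p ^ k) ^ 2 := by rw [mul_comm, zpow_mul]; norm_cast
    have e3 : p ^ (4 * n) = (p ^ n) ^ 4 := by rw [← pow_mul]; ring_nf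
    have e4 : p ^ (2 * (2 * n)) = (p ^ n) ^ 4 := by rw [← pow_mul]; ring_nf
    have e5 : p ^ (2 * n) = (p ^ n) ^ 2 := by rw [← pow_mul]; ring_nf
    have e6 : p ^ (2 : ℤ) = p ^ 2 := by norm_cast
    simp only [e1, e2, e3, e4, e5, e6]
    have hk : p ^ k ≠ 0 := zpow_ne_zero _ hp0.ne'
    field_simp
    ring

lemma summable_zpow_sq_mul_zpow {p w : ℝ} (hp0 : 0 < p) (hp1 : p < 1) (hw : w ≠ 0) :
    Summable fun k : ℤ => p ^ (k ^ 2) * w ^ k := by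
  have hl : 0 < -Real.log p / Real.pi := div_pos (neg_pos.2 (Real.log_neg hp0 hp1)) Real.pi_pos
  have h := (summable_jacobiTheta₂_term_iff
    (Complex.I * (-Real.log |w| / (2 * Real.pi) : ℝ)) (Complex.I * (-Real.log p / Real.pi : ℝ))).2
    (by simpa using hl)
  refine h.norm.of_norm_bounded fun k => le_of_eq ?_
  rw [norm_jacobiTheta₂_term, norm_mul, norm_zpow, norm_zpow, Real.norm_of_nonneg hp0.le,
    Real.norm_eq_abs, ← Real.rpow_intCast, ← Real.rpow_intCast, Real.rpow_def_of_pos hp0,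
    Real.rpow_def_of_pos (abs_pos.2 hw), ← Real.exp_add]
  congr 1
  simp only [Complex.I_mul_im, Complex.ofReal_re]
  field_simp
  push_cast
  ring

/-- The product `∏ (1 + c x^(a i + b))`. -/
noncomputable def arithProd (x c : ℝ) (a b : ℕ) : ℝ := ∏' i : ℕ, (1 + c * x ^ (a * i + b))

lemma summable_norm_mul_pow_s3 {x : ℝ} (hx0 : 0 < x) (hx1 : x < 1) (c : ℝ) {a : ℕ} (ha : a ≠ 0)
    (b : ℕ) : Summable fun i : ℕ => ‖c * x ^ (a * i + b)‖ := by
  have h := (summable_geometric_of_lt_one (pow_nonneg hx0.le a)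
    (pow_lt_one₀ hx0.le hx1 ha)).mul_left (|c| * x ^ b)
  refine h.congr fun i => ?_
  rw [norm_mul, Real.norm_eq_abs, Real.norm_of_nonneg (by positivity), pow_add, pow_mul]
  ring

lemma hasProd_arithProd {x : ℝ} (hx0 : 0 < x) (hx1 : x < 1) (c : ℝ) {a : ℕ} (ha : a ≠ 0)
    (b : ℕ) : HasProd (fun i : ℕ => 1 + c * x ^ (a * i + b)) (arithProd x c a b) :=
  (multipliable_one_add_of_summable (summable_norm_mul_pow_s3 hx0 hx1 c ha b)).hasProd

lemma arithProd_neg_one_ne_zero {x : ℝ} (hx0 : 0 < x) (hx1 : x < 1) {a b : ℕ} (ha : a ≠ 0)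
    (hb : b ≠ 0) : arithProd x (-1) a b ≠ 0 := by
  refine tprod_one_add_ne_zero_of_summable (fun i => ?_) (summable_norm_mul_pow_s3 hx0 hx1 _ ha b)
  have := one_sub_pow_pos hx0 hx1 (n := a * i + b) (by omega)
  linarith

lemma tendsto_qFact {q : ℝ} (hq0 : 0 < q) (hq1 : q < 1) :
    Tendsto (qFact q) atTop (𝓝 (arithProd q (-1) 1 1)) := by
  convert (hasProd_arithProd hq0 hq1 (-1) one_ne_zero 1).tendsto_prod_nat using 2 with n
  simp [qFact, sub_eq_add_neg]

lemma qFact_antitone {q : ℝ} (hq0 : 0 < q) (hq1 : q < 1) : Antitone (qFact q) := by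
  refine antitone_nat_of_succ_le fun n => ?_
  rw [qFact_succ]
  have := pow_pos hq0 (n + 1)
  exact mul_le_of_le_one_right (qFact_pos hq0 hq1 n).le (by linarith)

/-- The **Jacobi triple product** identity. -/
theorem jacobi_tripleProduct {p w : ℝ} (hp0 : 0 < p) (hp1 : p < 1) (hw : w ≠ 0) :
    ∑' k : ℤ, p ^ (k ^ 2) * w ^ k =
      arithProd p (-1) 2 2 * arithProd p w 2 1 * arithProd p w⁻¹ 2 1 := by
  have hq0 : 0 < p ^ 2 := by positivity
  have hq1 : p ^ 2 < 1 := pow_lt_one₀ hp0.le hp1 two_ne_zero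
  set e := arithProd (p ^ 2) (-1) 1 1 with he
  have hee : arithProd p (-1) 2 2 = e := by
    simp only [he, arithProd, ← pow_mul]
    exact tprod_congr fun i => by ring
  have hlim := tendsto_qFact hq0 hq1
  have hle (n : ℕ) : e ≤ qFact (p ^ 2) n := (qFact_antitone hq0 hq1).le_of_tendsto hlim n
  have he0 : 0 < e := lt_of_le_of_ne
    (ge_of_tendsto' hlim fun n => (qFact_pos hq0 hq1 n).le)
    (arithProd_neg_one_ne_zero hq0 hq1 one_ne_zero one_ne_zero).symm
  have hr0 (m : ℤ) : 0 ≤ qFactInv (p ^ 2) m := by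
    unfold qFactInv
    split_ifs
    · rfl
    · exact inv_nonneg.2 (qFact_pos hq0 hq1 _).le
  have hr1 (m : ℤ) : qFactInv (p ^ 2) m ≤ e⁻¹ := by
    unfold qFactInv
    split_ifs
    · positivity
    · exact inv_anti₀ he0 (hle _)
  have hrlim {f : ℕ → ℤ} (hf : Tendsto f atTop atTop) :
      Tendsto (fun n => qFactInv (p ^ 2) (f n)) atTop (𝓝 e⁻¹) := by
    have h : Tendsto (fun n => (f n).toNat) atTop atTop :=
      tendsto_atTop.2 fun b => (tendsto_atTop.1 hf b).mono fun n hn => by omega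
    refine ((hlim.comp h).inv₀ he0.ne').congr' ?_
    filter_upwards [tendsto_atTop.1 hf 0] with n hn
    simp [qFactInv, not_lt.2 hn]
  have hQ1 (n : ℕ) : qFact (p ^ 2) n ≤ 1 := by
    simpa [qFact] using qFact_antitone hq0 hq1 n.zero_le
  have key := tendsto_tsum_of_dominated_convergence (𝓕 := atTop)
    (f := fun (n : ℕ) (k : ℤ) => qFact (p ^ 2) (2 * n) * qFactInv (p ^ 2) (n + k) *
        qFactInv (p ^ 2) (n - k) * (p ^ (k ^ 2) * w ^ k))
    (g := fun k : ℤ => e * e⁻¹ * e⁻¹ * (p ^ (k ^ 2) * w ^ k))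
    ((summable_zpow_sq_mul_zpow hp0 hp1 hw).norm.mul_left (1 * e⁻¹ * e⁻¹)) ?_ ?_
  · have hfin := tendsto_nhds_unique (key.congr fun n =>
      ((hasSum_finite_tripleProduct hp0 hp1 hw n).tsum_eq.trans Finset.prod_mul_distrib))
      ((hasProd_arithProd hp0 hp1 w two_ne_zero 1).tendsto_prod_nat.mul
        (hasProd_arithProd hp0 hp1 w⁻¹ two_ne_zero 1).tendsto_prod_nat)
    rw [tsum_mul_left, mul_inv_cancel₀ he0.ne', one_mul] at hfin
    rw [hee, mul_assoc, ← hfin, mul_inv_cancel_left₀ he0.ne']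
  · intro k
    refine Tendsto.mul_const _ (((hlim.comp ?_).mul (hrlim ?_)).mul (hrlim ?_))
    · exact tendsto_atTop.2 fun b => eventually_atTop.2 ⟨b, fun n hn => by omega⟩
    · exact tendsto_atTop.2 fun b => eventually_atTop.2 ⟨(b - k).toNat, fun n hn => by omega⟩
    · exact tendsto_atTop.2 fun b => eventually_atTop.2 ⟨(b + k).toNat, fun n hn => by omega⟩
  · refine Eventually.of_forall fun n k => ?_
    rw [norm_mul, norm_mul, norm_mul, Real.norm_of_nonneg (qFact_pos hq0 hq1 _).le,
      Real.norm_of_nonneg (hr0 _), Real.norm_of_nonneg (hr0 _)]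
    gcongr
    · exact hr0 _
    · exact hr0 _
    · exact hQ1 _
    · exact hr1 _
    · exact hr1 _

lemma arithProd_pow_mul_zpow {x c : ℝ} (hx0 : 0 < x) {a d : ℕ} {b : ℤ} (hd : (d : ℤ) = a + b) :
    arithProd (x ^ a) (c * x ^ b) 2 1 = arithProd x c (2 * a) d := by
  refine tprod_congr fun i => ?_
  have h : x ^ b * (x ^ a) ^ (2 * i + 1) = x ^ (2 * a * i + d) := by
    rw [← pow_mul, ← zpow_natCast, ← zpow_natCast x (2 * a * i + d), ← zpow_add₀ hx0.ne']
    congr 1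
    push_cast
    rw [hd]
    ring
  rw [mul_assoc, h]

lemma arithProd_split {x : ℝ} (hx0 : 0 < x) (hx1 : x < 1) (c : ℝ) {a : ℕ} (ha : a ≠ 0) (b r : ℕ)
    [NeZero r] :
    arithProd x c a b = ∏ j ∈ Finset.range r, arithProd x c (a * r) (a * j + b) := by
  rw [Finset.prod_range]
  have h := ((Nat.divModEquiv r).trans (Equiv.prodComm _ _)).symm.hasProd_iff.2
    (hasProd_arithProd hx0 hx1 c ha b)
  refine (h.prod_fiberwise (g := fun j : Fin r => arithProd x c (a * r) (a * j + b))
    fun j => ?_).unique (hasProd_fintype _)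
  convert hasProd_arithProd hx0 hx1 c (mul_ne_zero ha (NeZero.ne r)) (a * j + b) using 2 with i
  simp only [Function.comp_apply, Equiv.symm_trans_apply, Equiv.prodComm_symm,
    Equiv.prodComm_apply, Prod.swap_prod_mk, Nat.divModEquiv_symm_apply]
  ring_nf

lemma arithProd_one_mul_arithProd_neg_one {x : ℝ} (hx0 : 0 < x) (hx1 : x < 1) {a : ℕ}
    (ha : a ≠ 0) (b : ℕ) :
    arithProd x 1 a b * arithProd x (-1) a b = arithProd x (-1) (2 * a) (2 * b) := by
  refine ((hasProd_arithProd hx0 hx1 1 ha b).mul (hasProd_arithProd hx0 hx1 (-1) ha b)).unique ?_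
  convert hasProd_arithProd hx0 hx1 (-1) (mul_ne_zero two_ne_zero ha) (2 * b) using 2 with i
  ring

/-- The theta series `∑ c^k y^(a k² + b k)` over all integers `k`. -/
noncomputable def thetaSum (y c : ℝ) (a b : ℤ) : ℝ := ∑' k : ℤ, c ^ k * y ^ (a * k ^ 2 + b * k)

lemma zpow_theta_term {y : ℝ} (hy0 : 0 < y) (c : ℝ) (a : ℕ) (b k : ℤ) :
    (y ^ a) ^ (k ^ 2) * (c * y ^ b) ^ k = c ^ k * y ^ (a * k ^ 2 + b * k) := by
  rw [zpow_add₀ hy0.ne', mul_zpow, zpow_mul, zpow_mul, zpow_natCast]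
  ring

lemma summable_theta_s3 {y c : ℝ} (hy0 : 0 < y) (hy1 : y < 1) (hc : c ≠ 0) {a : ℤ} (ha : 0 < a)
    (b : ℤ) : Summable fun k : ℤ => c ^ k * y ^ (a * k ^ 2 + b * k) := by
  lift a to ℕ using ha.le
  refine (summable_zpow_sq_mul_zpow (pow_pos hy0 a) (pow_lt_one₀ hy0.le hy1 (by omega))
    (mul_ne_zero hc (zpow_ne_zero b hy0.ne'))).congr fun k => ?_
  rw [zpow_theta_term hy0]

lemma thetaSum_eq_arithProd {y c : ℝ} (hy0 : 0 < y) (hy1 : y < 1) (hc : c * c = 1) {a d e : ℕ}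
    {b : ℤ} (ha : a ≠ 0) (hd : (d : ℤ) = a + b) (he : (e : ℤ) = a - b) :
    thetaSum y c a b =
      arithProd y (-1) (2 * a) (2 * a) * arithProd y c (2 * a) d * arithProd y c (2 * a) e := by
  have hc0 : c ≠ 0 := left_ne_zero_of_mul_eq_one hc
  have hi : (c * y ^ b)⁻¹ = c * y ^ (-b) := by
    rw [mul_inv, zpow_neg, inv_eq_of_mul_eq_one_left hc]
  have h := jacobi_tripleProduct (pow_pos hy0 a) (pow_lt_one₀ hy0.le hy1 ha)
    (mul_ne_zero hc0 (zpow_ne_zero b hy0.ne'))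
  rw [hi, arithProd_pow_mul_zpow hy0 hd, arithProd_pow_mul_zpow hy0 (he.trans (sub_eq_add_neg _ _))]
    at h
  have h2 : arithProd (y ^ a) (-1) 2 2 = arithProd y (-1) (2 * a) (2 * a) :=
    tprod_congr fun i => by ring
  rw [← h2, ← h]
  exact tsum_congr fun k => (zpow_theta_term hy0 c a b k).symm

lemma thetaSum_neg {y c : ℝ} (hc : c * c = 1) (a b : ℤ) :
    thetaSum y c a (-b) = thetaSum y c a b := by
  refine ((Equiv.neg ℤ).tsum_eq _).symm.trans (tsum_congr fun k => ?_)
  have hi : c⁻¹ = c := inv_eq_of_mul_eq_one_left hc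
  rw [Equiv.neg_apply, zpow_neg, ← inv_zpow, hi]
  ring_nf

lemma thetaSum_shift {y c : ℝ} (hy0 : 0 < y) (hc : c ≠ 0) (a b : ℤ) :
    thetaSum y c a b = c * y ^ (a + b) * thetaSum y c a (b + 2 * a) := by
  rw [thetaSum, thetaSum, ← tsum_mul_left]
  refine ((Equiv.addRight (1 : ℤ)).tsum_eq _).symm.trans (tsum_congr fun k => ?_)
  rw [Equiv.coe_addRight, zpow_add₀ hc, zpow_one, mul_mul_mul_comm, ← zpow_add₀ hy0.ne']
  ring_nf

lemma hasSum_zpow_sub_zpow {y : ℝ} (hy0 : 0 < y) (hy1 : y < 1) {a : ℤ} (ha : 0 < a)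
    (b d e : ℤ) : HasSum (fun k : ℤ => y ^ (a * k ^ 2 + b * k) - y ^ (a * k ^ 2 + d * k + e))
      (thetaSum y 1 a b - y ^ e * thetaSum y 1 a d) := by
  refine (congrArg (HasSum · _) (funext fun k => ?_)).mpr
    ((summable_theta_s3 hy0 hy1 one_ne_zero ha b).hasSum.sub
      ((summable_theta_s3 hy0 hy1 one_ne_zero ha d).hasSum.mul_left (y ^ e)))
  rw [one_zpow, one_mul, one_mul, zpow_add₀ hy0.ne' _ e, mul_comm (y ^ e)]

lemma thetaSum_neg_one_eq {y : ℝ} (hy0 : 0 < y) (hy1 : y < 1) {a : ℤ} (ha : 0 < a) (b : ℤ) :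
    thetaSum y (-1) a b =
      thetaSum y 1 (4 * a) (2 * b) - y ^ (a + b) * thetaSum y 1 (4 * a) (4 * a + 2 * b) := by
  have h := (Int.divModEquiv 2).symm.hasSum_iff.2
    (summable_theta_s3 hy0 hy1 (neg_ne_zero.2 one_ne_zero) ha b).hasSum
  have h2 := h.prod_fiberwise fun k => hasSum_fintype _
  refine h2.unique ?_
  convert hasSum_zpow_sub_zpow hy0 hy1 (a := 4 * a) (by omega) (2 * b) (4 * a + 2 * b) (a + b)
    using 2 with k
  have h3 : (-1 : ℝ) ^ (k * 2) = 1 := by rw [mul_comm, zpow_mul]; norm_num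
  simp only [Function.comp_apply, Int.divModEquiv_symm_apply, Fin.sum_univ_two, Fin.val_zero,
    Fin.val_one, Nat.cast_zero, Nat.cast_one, Nat.cast_ofNat, add_zero, h3,
    zpow_add₀ (neg_ne_zero.2 (one_ne_zero (α := ℝ)))]
  ring_nf

lemma negOne_zpow_neg (n : ℤ) : (-1 : ℝ) ^ (-n) = (-1) ^ n := by
  rw [zpow_neg, ← inv_zpow]
  norm_num

lemma tsum_dissection_zero {y : ℝ} (hy0 : 0 < y) (a : ℤ) :
    ∑' n : ℤ, (-1 : ℝ) ^ n *
    y ^ (60 * n ^ 2 - 20 * n - 40 * (a * 3) * n + 10 * (a * 3) ^ 2 + 8 * (a * 3)) =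
    (-1) ^ a * y ^ (30 * a ^ 2 + 4 * a) * thetaSum y (-1) 60 20 := by
  have hn : (-1 : ℝ) ≠ 0 := neg_ne_zero.2 one_ne_zero
  rw [thetaSum, ← tsum_mul_left]
  refine ((Equiv.subLeft a).tsum_eq _).symm.trans (tsum_congr fun n => ?_)
  rw [Equiv.subLeft_apply, sub_eq_add_neg a n, zpow_add₀ hn, negOne_zpow_neg, mul_mul_mul_comm,
    ← zpow_add₀ hy0.ne']
  ring_nf

lemma tsum_dissection_one (y : ℝ) (a : ℤ) :
    ∑' n : ℤ, (-1 : ℝ) ^ n *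
    y ^ (60 * n ^ 2 - 20 * n - 40 * (a * 3 + 1) * n + 10 * (a * 3 + 1) ^ 2 + 8 * (a * 3 + 1)) =
    0 := by
  have hn : (-1 : ℝ) ≠ 0 := neg_ne_zero.2 one_ne_zero
  refine self_eq_neg.1 (((Equiv.subLeft (2 * a + 1)).tsum_eq _).symm.trans ?_)
  rw [← tsum_neg]
  refine tsum_congr fun n => ?_
  have h2 : (-1 : ℝ) ^ (2 * a) = 1 := by rw [zpow_mul]; norm_num
  rw [Equiv.subLeft_apply, sub_eq_add_neg _ n, zpow_add₀ hn, zpow_add₀ hn, negOne_zpow_neg, h2]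
  ring_nf

lemma tsum_dissection_two {y : ℝ} (hy0 : 0 < y) (a : ℤ) :
    ∑' n : ℤ, (-1 : ℝ) ^ n *
    y ^ (60 * n ^ 2 - 20 * n - 40 * (a * 3 + 2) * n + 10 * (a * 3 + 2) ^ 2 + 8 * (a * 3 + 2)) =
    -(y ^ 16 * ((-1) ^ a * y ^ (30 * a ^ 2 + 44 * a))) * thetaSum y (-1) 60 20 := by
  have hn : (-1 : ℝ) ≠ 0 := neg_ne_zero.2 one_ne_zero
  rw [thetaSum, ← tsum_mul_left]
  refine ((Equiv.addRight (a + 1)).tsum_eq _).symm.trans (tsum_congr fun n => ?_)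
  have h16 : y ^ 16 = y ^ (16 : ℤ) := by norm_cast
  rw [Equiv.coe_addRight, zpow_add₀ hn, zpow_add₀ hn, zpow_one, h16,
    show -(y ^ (16 : ℤ) * ((-1) ^ a * y ^ (30 * a ^ 2 + 44 * a))) *
      ((-1) ^ n * y ^ (60 * n ^ 2 + 20 * n)) = (-1) ^ n * ((-1) ^ a * -1) *
      (y ^ (16 : ℤ) * y ^ (30 * a ^ 2 + 44 * a) * y ^ (60 * n ^ 2 + 20 * n)) by ring,
    ← zpow_add₀ hy0.ne', ← zpow_add₀ hy0.ne']
  ring_nf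

lemma hasSum_tsum_shear {f g : ℤ → ℝ} (hf : Summable f) (hg : Summable g) (c : ℤ) :
    HasSum (fun M : ℤ => ∑' n : ℤ, f (M - c * n) * g n) ((∑' n, f n) * ∑' n, g n) := by
  let e : ℤ × ℤ ≃ ℤ × ℤ :=
    { toFun := fun z => (z.1 - c * z.2, z.2)
      invFun := fun z => (z.1 + c * z.2, z.2)
      left_inv := fun z => by simp
      right_inv := fun z => by simp }
  have hfg : Summable fun z : ℤ × ℤ => f z.1 * g z.2 :=
    summable_mul_of_summable_norm hf.norm hg.norm
  have hprod := e.hasSum_iff.2 (hf.hasSum.mul hg.hasSum hfg)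
  exact hprod.prod_fiberwise fun M => (hprod.summable.prod_factor M).hasSum

/-- The product of two theta series as a double sum over a sheared lattice. -/
lemma hasSum_thetaSum_mul_thetaSum {y : ℝ} (hy0 : 0 < y) (hy1 : y < 1) :
    HasSum (fun M : ℤ => ∑' n : ℤ,
        (-1 : ℝ) ^ n * y ^ (60 * n ^ 2 - 20 * n - 40 * M * n + 10 * M ^ 2 + 8 * M))
      (thetaSum y 1 10 8 * thetaSum y (-1) 20 (-4)) := by
  have h := hasSum_tsum_shear (summable_theta_s3 hy0 hy1 one_ne_zero (a := 10) (by norm_num) 8)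
    (summable_theta_s3 hy0 hy1 (neg_ne_zero.2 one_ne_zero) (a := 20) (by norm_num) (-4)) 2
  refine (congrArg (HasSum · _) (funext fun M => tsum_congr fun n => ?_)).mp h
  rw [one_zpow, one_mul, mul_left_comm, ← zpow_add₀ hy0.ne']
  ring_nf

/-- A form of the quintuple product identity: the product of two theta series,
dissected modulo three. -/
theorem thetaSum_mul_thetaSum {y : ℝ} (hy0 : 0 < y) (hy1 : y < 1) :
    thetaSum y 1 10 8 * thetaSum y (-1) 20 (-4) =
      (thetaSum y (-1) 30 4 - y ^ 16 * thetaSum y (-1) 30 44) * thetaSum y (-1) 60 20 := by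
  have hn : (-1 : ℝ) ≠ 0 := neg_ne_zero.2 one_ne_zero
  have h3 := HasSum.prod_fiberwise
    ((Int.divModEquiv 3).symm.hasSum_iff.2 (hasSum_thetaSum_mul_thetaSum hy0 hy1))
    fun a => hasSum_fintype _
  simp only [Function.comp_apply, Int.divModEquiv_symm_apply, Fin.sum_univ_three, Fin.val_zero,
    Fin.val_one, Fin.val_two, Nat.cast_zero, Nat.cast_one, Nat.cast_ofNat, add_zero,
    tsum_dissection_zero hy0, tsum_dissection_one, tsum_dissection_two hy0, ← add_mul] at h3
  have hF := ((summable_theta_s3 hy0 hy1 hn (a := 30) (by norm_num) 4).hasSum.sub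
    ((summable_theta_s3 hy0 hy1 hn (a := 30) (by norm_num) 44).hasSum.mul_left (y ^ 16))).mul_right
      (thetaSum y (-1) 60 20)
  simp only [sub_eq_add_neg] at hF
  exact h3.unique hF

theorem thetaSum_sub_mul_arithProd {y : ℝ} (hy0 : 0 < y) (hy1 : y < 1) :
    (thetaSum y (-1) 30 4 - y ^ 16 * thetaSum y (-1) 30 44) * arithProd y (-1) 2 2 =
      thetaSum y (-1) 5 1 * arithProd y (-1) 4 4 := by
  have key := thetaSum_mul_thetaSum hy0 hy1
  have t1 := thetaSum_eq_arithProd hy0 hy1 (c := 1) (by norm_num) (a := 10) (b := 8) (d := 18)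
    (e := 2) (by norm_num) (by norm_num) (by norm_num)
  have t2 := thetaSum_eq_arithProd hy0 hy1 (c := -1) (by norm_num) (a := 20) (b := -4) (d := 16)
    (e := 24) (by norm_num) (by norm_num) (by norm_num)
  have t3 := thetaSum_eq_arithProd hy0 hy1 (c := -1) (by norm_num) (a := 60) (b := 20) (d := 80)
    (e := 40) (by norm_num) (by norm_num) (by norm_num)
  have t4 := thetaSum_eq_arithProd hy0 hy1 (c := -1) (by norm_num) (a := 5) (b := 1) (d := 6)
    (e := 4) (by norm_num) (by norm_num) (by norm_num)
  have s40 := arithProd_split hy0 hy1 (-1) (a := 40) (by norm_num) 40 3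
  have s2 := arithProd_split hy0 hy1 (-1) (a := 2) (by norm_num) 2 5
  have s4 := arithProd_split hy0 hy1 (-1) (a := 4) (by norm_num) 4 5
  have s1 := arithProd_split hy0 hy1 (-1) (a := 10) (by norm_num) 2 2
  have s8 := arithProd_split hy0 hy1 (-1) (a := 10) (by norm_num) 8 2
  have r4 := arithProd_split hy0 hy1 (-1) (a := 20) (by norm_num) 4 2
  have r16 := arithProd_split hy0 hy1 (-1) (a := 20) (by norm_num) 16 2
  have p18 := arithProd_one_mul_arithProd_neg_one hy0 hy1 (a := 20) (by norm_num) 18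
  have p2 := arithProd_one_mul_arithProd_neg_one hy0 hy1 (a := 20) (by norm_num) 2
  have nz := arithProd_neg_one_ne_zero hy0 hy1 (a := 40) (b := 40) (by norm_num) (by norm_num)
  simp only [Finset.prod_range_succ, Finset.prod_range_zero, Nat.reduceMul, Nat.reduceAdd,
    mul_zero, mul_one, zero_add, one_mul, Nat.cast_ofNat] at *
  have hF : thetaSum y (-1) 30 4 - y ^ 16 * thetaSum y (-1) 30 44 =
      arithProd y (-1) 20 20 * arithProd y 1 20 18 * arithProd y 1 20 2 *
        arithProd y (-1) 40 16 * arithProd y (-1) 40 24 := by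
    refine mul_right_cancel₀ nz ?_
    linear_combination t1 * thetaSum y (-1) 20 (-4) - key +
      arithProd y (-1) 20 20 * arithProd y 1 20 18 * arithProd y 1 20 2 * t2 +
      (thetaSum y (-1) 30 4 - y ^ 16 * thetaSum y (-1) 30 44) * (s40 - t3)
  rw [hF, t4, s2, s4, s1, s8, r4, r16, ← p18, ← p2]
  ring

lemma eulerProd_pow (y : ℝ) (a : ℕ) : eulerProd (y ^ a) = arithProd y (-1) a a := by
  refine tprod_congr fun i => ?_
  rw [← pow_mul]
  ring

theorem chi_5_6_sum_eq_chi_2_5_1_2_sqrt (q : ℝ) (hq0 : 0 < q) (hq1 : q < 1) :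
    minChar 5 6 2 2 q + minChar 5 6 2 4 q = minChar 2 5 1 2 (q ^ ((1 : ℝ) / 2)) := by
  obtain ⟨y, hy0, hy1, rfl⟩ : ∃ y : ℝ, 0 < y ∧ y < 1 ∧ y ^ 4 = q :=
    ⟨q ^ ((1 : ℝ) / 4), Real.rpow_pos_of_pos hq0 _, Real.rpow_lt_one hq0.le hq1 (by norm_num), by
      rw [← Real.rpow_mul_natCast hq0.le]; norm_num⟩
  have hsqrt : (y ^ 4) ^ ((1 : ℝ) / 2) = y ^ 2 := by
    rw [← Real.rpow_natCast_mul hy0.le, ← Real.rpow_natCast]; norm_num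
  have hpow (n : ℕ) (r : ℝ) : (y ^ n) ^ r = y ^ (n * r) := (Real.rpow_natCast_mul hy0.le _ _).symm
  have hzpow (n : ℕ) (k : ℤ) : (y ^ n) ^ k = y ^ (n * k) := by rw [zpow_mul, zpow_natCast]
  have e1 : arithProd y (-1) 2 2 ≠ 0 :=
    arithProd_neg_one_ne_zero hy0 hy1 two_ne_zero two_ne_zero
  have e2 : arithProd y (-1) 4 4 ≠ 0 :=
    arithProd_neg_one_ne_zero hy0 hy1 four_ne_zero four_ne_zero
  have s1 := (hasSum_zpow_sub_zpow hy0 hy1 (a := 120) (by norm_num) 8 88 16).tsum_eq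
  have s2 := (hasSum_zpow_sub_zpow hy0 hy1 (a := 120) (by norm_num) (-32) 128 32).tsum_eq
  have s3 := (hasSum_zpow_sub_zpow hy0 hy1 (a := 20) (by norm_num) 2 18 4).tsum_eq
  have c1 : minChar 5 6 2 2 (y ^ 4) = y ^ (-(1 / 30) : ℝ) * (arithProd y (-1) 4 4)⁻¹ *
      (thetaSum y 1 120 8 - y ^ (16 : ℤ) * thetaSum y 1 120 88) := by
    rw [minChar, eulerProd_pow, hpow, ← s1]
    simp only [hzpow]
    congr 2
    · norm_num
    · ext k
      ring_nf
  have c2 : minChar 5 6 2 4 (y ^ 4) = y ^ (-(1 / 30) : ℝ) * y ^ 2 * (arithProd y (-1) 4 4)⁻¹ *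
      (thetaSum y 1 120 (-32) - y ^ (32 : ℤ) * thetaSum y 1 120 128) := by
    rw [minChar, eulerProd_pow, hpow, ← s2, ← Real.rpow_natCast y 2, ← Real.rpow_add hy0]
    simp only [hzpow]
    congr 2
    · norm_num
    · ext k
      ring_nf
  have c3 : minChar 2 5 1 2 (y ^ 2) = y ^ (-(1 / 30) : ℝ) * (arithProd y (-1) 2 2)⁻¹ *
      (thetaSum y 1 20 2 - y ^ (4 : ℤ) * thetaSum y 1 20 18) := by
    rw [minChar, eulerProd_pow, hpow, ← s3]
    simp only [hzpow]
    congr 2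
    · norm_num
    · ext k
      ring_nf
  have d1 := thetaSum_neg_one_eq hy0 hy1 (a := 30) (by norm_num) 4
  have d2 := thetaSum_neg_one_eq hy0 hy1 (a := 30) (by norm_num) 44
  have d3 := thetaSum_neg_one_eq hy0 hy1 (a := 5) (by norm_num) 1
  have h1 := thetaSum_shift hy0 (c := 1) one_ne_zero 120 (-32)
  have h2 := thetaSum_shift hy0 (c := 1) one_ne_zero 20 (-18)
  have h3 := thetaSum_neg (y := y) (c := 1) (by norm_num) 20 18
  have key := thetaSum_sub_mul_arithProd hy0 hy1
  norm_num at d1 d2 d3 h1 h2 h3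
  rw [hsqrt, c1, c2, c3, h1, ← h3, h2]
  rw [d1, d2, d3] at key
  field_simp
  norm_cast at key ⊢
  linear_combination key
end

section
/- For every real number q with 0 < q < 1, the following identity between minimal model characters of central charges 4/5 and −22/5 holds: χ_{5,6}^{1,1}(q) − χ_{5,6}^{1,5}(q) = χ_{2,5}^{1,2}(q^{2}). -/
open scoped BigOperators

open Filter Topology

/-- The infinite `q`-Pochhammer symbol `(x; b)_∞`. -/
noncomputable def qPochInf (x b : ℝ) : ℝ := ∏' i : ℕ, (1 - x * b ^ i)

section QPochhammer

variable {b : ℝ}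

lemma summable_neg_mul_pow (hb0 : 0 < b) (hb1 : b < 1) (x : ℝ) :
    Summable fun i : ℕ ↦ -(x * b ^ i) :=
  ((summable_geometric_of_lt_one hb0.le hb1).mul_left x).neg

lemma multipliable_one_sub_mul_pow (hb0 : 0 < b) (hb1 : b < 1) (x : ℝ) :
    Multipliable fun i : ℕ ↦ (1 - x * b ^ i) := by
  simpa only [sub_eq_add_neg] using
    Real.multipliable_one_add_of_summable (summable_neg_mul_pow hb0 hb1 x)

lemma tendsto_prod_qPochInf (hb0 : 0 < b) (hb1 : b < 1) (x : ℝ) :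
    Tendsto (fun n ↦ ∏ i ∈ Finset.range n, (1 - x * b ^ i)) atTop (𝓝 (qPochInf x b)) :=
  (multipliable_one_sub_mul_pow hb0 hb1 x).tendsto_prod_tprod_nat

lemma one_sub_mul_pow_pos (hb0 : 0 < b) (hb1 : b < 1) {x : ℝ} (hx0 : 0 ≤ x) (hx1 : x < 1)
    (i : ℕ) : 0 < 1 - x * b ^ i := by
  have h : x * b ^ i ≤ x * 1 := mul_le_mul_of_nonneg_left (pow_le_one₀ hb0.le hb1.le) hx0
  linarith

lemma qPochInf_pos (hb0 : 0 < b) (hb1 : b < 1) {x : ℝ} (hx0 : 0 ≤ x) (hx1 : x < 1) :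
    0 < qPochInf x b := by
  have hs := Real.summable_log_one_add_of_summable (summable_neg_mul_pow hb0 hb1 x)
  simp only [← sub_eq_add_neg] at hs
  rw [qPochInf, ← Real.rexp_tsum_eq_tprod (one_sub_mul_pow_pos hb0 hb1 hx0 hx1) hs]
  exact Real.exp_pos _

lemma qPochInf_le_prod (hb0 : 0 < b) (hb1 : b < 1) {x : ℝ} (hx0 : 0 ≤ x) (hx1 : x < 1) (n : ℕ) :
    qPochInf x b ≤ ∏ i ∈ Finset.range n, (1 - x * b ^ i) := by
  refine Antitone.le_of_tendsto (antitone_nat_of_succ_le fun m ↦ ?_)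
    (tendsto_prod_qPochInf hb0 hb1 x) n
  rw [Finset.prod_range_succ]
  refine mul_le_of_le_one_right
    (Finset.prod_nonneg fun i _ ↦ (one_sub_mul_pow_pos hb0 hb1 hx0 hx1 i).le) ?_
  have : 0 ≤ x * b ^ m := by positivity
  linarith

/-- Splitting the factors of `(x; b)_∞` according to the residue of their index modulo `m`. -/
lemma qPochInf_eq_prod (hb0 : 0 < b) (hb1 : b < 1) (x : ℝ) {m : ℕ} (hm : m ≠ 0) :
    qPochInf x b = ∏ r ∈ Finset.range m, qPochInf (x * b ^ r) (b ^ m) := by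
  have hlim := (tendsto_prod_qPochInf hb0 hb1 x).comp
    (tendsto_id.const_mul_atTop' (Nat.pos_of_ne_zero hm))
  refine tendsto_nhds_unique hlim ?_
  have hprod := tendsto_finsetProd (Finset.range m) fun r _ ↦
    tendsto_prod_qPochInf (pow_pos hb0 m) (pow_lt_one₀ hb0.le hb1 hm) (x * b ^ r)
  refine hprod.congr fun N ↦ ?_
  rw [Finset.prod_comm]
  simp only [Function.comp, id]
  induction N with
  | zero => simp
  | succ N ih =>
    rw [Finset.prod_range_succ, ih, Nat.mul_succ, Finset.prod_range_add]
    congr 1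
    refine Finset.prod_congr rfl fun r _ ↦ ?_
    ring

end QPochhammer

section JacobiTripleProduct

variable {b : ℝ}

/-- The reciprocal `1 / (b; b)_m`, extended by zero to negative indices `m`. -/
noncomputable def invQPoch (b : ℝ) (m : ℤ) : ℝ :=
  if 0 ≤ m then (∏ i ∈ Finset.range m.toNat, (1 - b * b ^ i))⁻¹ else 0

lemma invQPoch_sub_one (hb0 : 0 < b) (hb1 : b < 1) (m : ℤ) :
    invQPoch b (m - 1) = (1 - b ^ m) * invQPoch b m := by
  rcases lt_trichotomy m 0 with hm | rfl | hm
  · rw [invQPoch, invQPoch, if_neg (by omega), if_neg (by omega), mul_zero]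
  · simp [invQPoch]
  · obtain ⟨k, rfl⟩ : ∃ k : ℕ, m = k + 1 := ⟨(m - 1).toNat, by omega⟩
    have hne := (one_sub_mul_pow_pos hb0 hb1 hb0.le hb1 k).ne'
    rw [invQPoch, invQPoch, if_pos (by omega), if_pos (by omega)]
    have h1 : ((k : ℤ) + 1 - 1).toNat = k := by omega
    have h2 : ((k : ℤ) + 1).toNat = k + 1 := by omega
    have h3 : b ^ ((k : ℤ) + 1) = b * b ^ k := by
      rw [zpow_add_one₀ hb0.ne', zpow_natCast, mul_comm]
    rw [h1, h2, h3, Finset.prod_range_succ, mul_inv, mul_comm, mul_assoc, inv_mul_cancel₀ hne,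
      mul_one]

lemma invQPoch_nonneg (hb0 : 0 < b) (hb1 : b < 1) (m : ℤ) : 0 ≤ invQPoch b m := by
  unfold invQPoch
  split_ifs
  · exact inv_nonneg.2
      (Finset.prod_nonneg fun i _ ↦ (one_sub_mul_pow_pos hb0 hb1 hb0.le hb1 i).le)
  · exact le_rfl

lemma invQPoch_le (hb0 : 0 < b) (hb1 : b < 1) (m : ℤ) :
    invQPoch b m ≤ (qPochInf b b)⁻¹ := by
  have hpos := qPochInf_pos hb0 hb1 hb0.le hb1
  unfold invQPoch
  split_ifs
  · exact inv_anti₀ hpos (qPochInf_le_prod hb0 hb1 hb0.le hb1 _)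
  · positivity

lemma tendsto_invQPoch (hb0 : 0 < b) (hb1 : b < 1) :
    Tendsto (invQPoch b) atTop (𝓝 (qPochInf b b)⁻¹) := by
  have htoNat : Tendsto Int.toNat atTop atTop :=
    tendsto_atTop.2 fun n ↦ (eventually_ge_atTop (n : ℤ)).mono fun m hm ↦ by omega
  have h := ((tendsto_prod_qPochInf hb0 hb1 b).inv₀
    (qPochInf_pos hb0 hb1 hb0.le hb1).ne').comp htoNat
  refine h.congr' ?_
  filter_upwards [eventually_ge_atTop 0] with m hm
  rw [invQPoch, if_pos hm, Function.comp]

/-- A bilateral sequence with consecutive ratios `-z b^k` is summable. -/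
lemma summable_of_ratio_zpow (hb0 : 0 < b) (hb1 : b < 1) {z : ℝ} (hz : z ≠ 0) {w : ℤ → ℝ}
    (hw : ∀ k, w (k + 1) = -z * b ^ k * w k) : Summable w := by
  have hpow (c : ℝ) : ∀ᶠ n : ℕ in atTop, c * b ^ n ≤ 1 / 2 := by
    have h := (tendsto_pow_atTop_nhds_zero_of_lt_one hb0.le hb1).const_mul c
    rw [mul_zero] at h
    exact h.eventually_le_const (by norm_num)
  apply Summable.of_nat_of_neg
  · refine summable_of_ratio_norm_eventually_le (r := 1 / 2) (by norm_num) ?_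
    filter_upwards [hpow |z|] with n hn
    have := hw n
    push_cast
    rw [this, norm_mul, norm_mul, norm_neg, zpow_natCast, norm_pow, Real.norm_of_nonneg hb0.le]
    exact mul_le_mul_of_nonneg_right hn (norm_nonneg _)
  · refine summable_of_ratio_norm_eventually_le (r := 1 / 2) (by norm_num) ?_
    filter_upwards [hpow (|z|⁻¹ * b)] with n hn
    have h := hw (-((n + 1 : ℕ) : ℤ))
    rw [show -((n + 1 : ℕ) : ℤ) + 1 = -(n : ℤ) by push_cast; ring, zpow_neg, zpow_natCast] at h
    have h' : w (-((n + 1 : ℕ) : ℤ)) = -(z⁻¹ * b ^ (n + 1) * w (-(n : ℤ))) := by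
      rw [h]
      field_simp
    rw [h', norm_neg, norm_mul]
    refine mul_le_mul_of_nonneg_right (le_trans (le_of_eq ?_) hn) (norm_nonneg _)
    rw [norm_mul, norm_inv, norm_pow, Real.norm_of_nonneg hb0.le, Real.norm_eq_abs, pow_succ]
    ring

/-- The finite Jacobi triple product, with both sides divided by `(b; b)_{2n}`. -/
lemma hasSum_invQPoch_mul_invQPoch (hb0 : 0 < b) (hb1 : b < 1) {z y : ℝ} (hzy : z * y = b)
    {w : ℤ → ℝ} (hw0 : w 0 = 1) (hw : ∀ k, w (k + 1) = -z * b ^ k * w k) (n : ℕ) :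
    HasSum (fun k : ℤ ↦ invQPoch b (n + k) * invQPoch b (n - k) * w k)
      ((∏ i ∈ Finset.range n, (1 - z * b ^ i)) * (∏ i ∈ Finset.range n, (1 - y * b ^ i)) *
        invQPoch b (2 * n)) := by
  induction n with
  | zero =>
    have h := hasSum_single (f := fun k : ℤ ↦ invQPoch b ((0 : ℕ) + k) *
      invQPoch b ((0 : ℕ) - k) * w k) 0 ?_
    · simpa [hw0, invQPoch] using h
    · intro k hk
      rcases lt_or_gt_of_ne hk with hk | hk
      · rw [invQPoch, if_neg (by simpa using hk)]; simp
      · rw [mul_right_comm, invQPoch.eq_def b (_ - k), if_neg (by simpa using hk)]; simp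
  | succ n ih =>
    have hbne := hb0.ne'
    set f : ℤ → ℝ := fun k ↦ invQPoch b (n + k) * invQPoch b (n - k) * w k with hf
    set D : ℝ := (1 - b ^ (2 * n + 1)) * (1 - b ^ (2 * n + 2)) with hD
    have hD0 : D ≠ 0 := mul_ne_zero
      (sub_pos.2 (pow_lt_one₀ hb0.le hb1 (by omega))).ne'
      (sub_pos.2 (pow_lt_one₀ hb0.le hb1 (by omega))).ne'
    have htop : invQPoch b (2 * n) = D * invQPoch b (2 * (n + 1 : ℕ)) := by
      have h1 := invQPoch_sub_one hb0 hb1 (2 * n + 1)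
      have h2 := invQPoch_sub_one hb0 hb1 (2 * n + 2)
      rw [show (2 * n + 1 - 1 : ℤ) = 2 * n by ring] at h1
      rw [show (2 * n + 2 - 1 : ℤ) = 2 * n + 1 by ring] at h2
      rw [h1, h2, hD, show (2 * (n + 1 : ℕ) : ℤ) = 2 * n + 2 by push_cast; ring,
        ← mul_assoc]
      norm_cast
    have hright := (Equiv.addRight (-1 : ℤ)).hasSum_iff.mpr (ih.mul_left (-z * b ^ n))
    have hleft := (Equiv.addRight (1 : ℤ)).hasSum_iff.mpr (ih.mul_left (-y * b ^ n))
    have htotal := (((ih.mul_left (1 + b * b ^ (2 * n))).add hright).add hleft).mul_left D⁻¹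
    refine (congrArg₂ (fun F s ↦ HasSum F s) (funext fun k ↦ ?_) ?_).mpr htotal
    · rw [eq_inv_mul_iff_mul_eq₀ hD0]
      simp only [Function.comp, Equiv.coe_addRight, hf]
      have hw1 : w k = -z * b ^ (k + -1) * w (k + -1) := by
        have := hw (k + -1)
        rwa [neg_add_cancel_right] at this
      have hu1 := invQPoch_sub_one hb0 hb1 (n + 1 + k)
      have hu2 := invQPoch_sub_one hb0 hb1 (n + k)
      have hv1 := invQPoch_sub_one hb0 hb1 (n + 1 - k)
      have hv2 := invQPoch_sub_one hb0 hb1 (n - k)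
      rw [show (n + 1 + k - 1 : ℤ) = n + k by ring] at hu1
      rw [show (n + 1 - k - 1 : ℤ) = n - k by ring] at hv1
      rw [show (n + (k + -1) : ℤ) = n + k - 1 by ring, show (n - (k + -1) : ℤ) = n + 1 - k by ring,
        show (n + (k + 1) : ℤ) = n + 1 + k by ring, show (n - (k + 1) : ℤ) = n - k - 1 by ring,
        hu2, hv2, hu1, hv1, hw k]
      push_cast
      set u := invQPoch b (n + 1 + k)
      set v := invQPoch b (n + 1 - k)
      have hwr : -z * b ^ n * w (k + -1) = b ^ (n + 1 - k : ℤ) * w k := by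
        rw [hw1, show (n + 1 - k : ℤ) = n - (k + -1) by ring, zpow_sub₀ hbne, zpow_natCast]
        field_simp
      have hA : b ^ (n + 1 + k : ℤ) = b * b ^ n * b ^ k := by
        rw [zpow_add₀ hbne, zpow_add_one₀ hbne, zpow_natCast]; ring
      have hA' : b ^ (n + k : ℤ) = b ^ n * b ^ k := by
        rw [zpow_add₀ hbne, zpow_natCast]
      have hB : b ^ (n + 1 - k : ℤ) = b * b ^ n * (b ^ k)⁻¹ := by
        rw [zpow_sub₀ hbne, zpow_add_one₀ hbne, zpow_natCast]; ring
      have hB' : b ^ (n - k : ℤ) = b ^ n * (b ^ k)⁻¹ := by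
        rw [zpow_sub₀ hbne, zpow_natCast]; ring
      have hK : b ^ k * (b ^ k)⁻¹ = 1 := mul_inv_cancel₀ (zpow_ne_zero _ hbne)
      rw [hB] at hwr
      rw [hA, hA', hB, hB', hD]
      have hr : -z * b ^ n * ((1 - b ^ n * b ^ k) * ((1 - b * b ^ n * b ^ k) * u) * v *
          w (k + -1)) = (1 - b ^ n * b ^ k) * ((1 - b * b ^ n * b ^ k) * u) * v *
          (b * b ^ n * (b ^ k)⁻¹ * w k) := by rw [← hwr]; ring
      have hl : -y * b ^ n * (u * ((1 - b ^ n * (b ^ k)⁻¹) *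
          ((1 - b * b ^ n * (b ^ k)⁻¹) * v)) * (-z * b ^ k * w k)) =
          u * ((1 - b ^ n * (b ^ k)⁻¹) * ((1 - b * b ^ n * (b ^ k)⁻¹) * v)) *
          (b * b ^ n * b ^ k * w k) := by rw [← hzy]; ring
      rw [hr, hl]
      generalize (b ^ k)⁻¹ = L at hK ⊢
      generalize b ^ k = K at hK ⊢
      obtain ⟨N, hN⟩ : ∃ N, N = b ^ n := ⟨_, rfl⟩
      have e1 : b ^ (2 * n + 1) = N * N * (K * L) * b := by rw [hK, hN]; ring
      have e2 : b ^ (2 * n + 2) = N * N * (K * L) * b ^ 2 := by rw [hK, hN]; ring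
      have e3 : b ^ (2 * n) = N * N * (K * L) := by rw [hK, hN]; ring
      rw [e1, e2, e3, ← hN]
      ring
    · rw [eq_inv_mul_iff_mul_eq₀ hD0, Finset.prod_range_succ, Finset.prod_range_succ, htop,
        show b * b ^ (2 * n) = z * y * b ^ n * b ^ n by rw [hzy]; ring]
      ring

/-- **Jacobi's triple product identity**, for a bilateral sequence `w` given by its ratios. -/
theorem tsum_eq_qPochInf_mul (hb0 : 0 < b) (hb1 : b < 1) {z y : ℝ} (hzy : z * y = b)
    {w : ℤ → ℝ} (hw0 : w 0 = 1) (hw : ∀ k, w (k + 1) = -z * b ^ k * w k) :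
    ∑' k, w k = qPochInf z b * qPochInf y b * qPochInf b b := by
  have hz : z ≠ 0 := by rintro rfl; simp at hzy; exact hb0.ne hzy
  have hpos := qPochInf_pos hb0 hb1 hb0.le hb1
  set C := (qPochInf b b)⁻¹ with hC
  have hlim : Tendsto (fun n : ℕ ↦ ∑' k : ℤ, invQPoch b (n + k) * invQPoch b (n - k) * w k)
      atTop (𝓝 (∑' k : ℤ, C * C * w k)) := by
    refine tendsto_tsum_of_dominated_convergence (bound := fun k ↦ C * C * ‖w k‖)
      ((summable_of_ratio_zpow hb0 hb1 hz hw).norm.mul_left _) (fun k ↦ ?_)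
      (Eventually.of_forall fun n k ↦ ?_)
    · have ht := tendsto_invQPoch hb0 hb1
      exact ((ht.comp (tendsto_atTop_add_const_right _ k tendsto_natCast_atTop_atTop)).mul
        (ht.comp (tendsto_atTop_add_const_right _ (-k) tendsto_natCast_atTop_atTop))).mul_const _
    · rw [norm_mul, norm_mul, Real.norm_of_nonneg (invQPoch_nonneg hb0 hb1 _),
        Real.norm_of_nonneg (invQPoch_nonneg hb0 hb1 _)]
      exact mul_le_mul_of_nonneg_right (mul_le_mul (invQPoch_le hb0 hb1 _)
        (invQPoch_le hb0 hb1 _) (invQPoch_nonneg hb0 hb1 _) (inv_nonneg.2 hpos.le))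
        (norm_nonneg _)
  have hprod : Tendsto (fun n : ℕ ↦ (∏ i ∈ Finset.range n, (1 - z * b ^ i)) *
      (∏ i ∈ Finset.range n, (1 - y * b ^ i)) * invQPoch b (2 * n))
      atTop (𝓝 (qPochInf z b * qPochInf y b * C)) :=
    ((tendsto_prod_qPochInf hb0 hb1 z).mul (tendsto_prod_qPochInf hb0 hb1 y)).mul
      ((tendsto_invQPoch hb0 hb1).comp
        (tendsto_natCast_atTop_atTop.const_mul_atTop' (by norm_num : (0 : ℤ) < 2)))
  have heq := tendsto_nhds_unique (hlim.congr fun n ↦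
    (hasSum_invQPoch_mul_invQPoch hb0 hb1 hzy hw0 hw n).tsum_eq) hprod
  rw [tsum_mul_left, hC] at heq
  field_simp at heq
  linarith

end JacobiTripleProduct

section QuintupleProduct

/-- The general term `(-x)^k p^(k² - k)` of the theta series in Jacobi's triple product. -/
noncomputable def thetaTerm (x p : ℝ) (k : ℤ) : ℝ := (-x) ^ k * p ^ (k ^ 2 - k)

variable {p : ℝ}

lemma thetaTerm_add_one (hp0 : 0 < p) {x : ℝ} (hx : x ≠ 0) (k : ℤ) :
    thetaTerm x p (k + 1) = -x * (p ^ 2) ^ k * thetaTerm x p k := by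
  rw [thetaTerm, thetaTerm, zpow_add_one₀ (neg_ne_zero.2 hx),
    show (k + 1) ^ 2 - (k + 1) = 2 * k + (k ^ 2 - k) by ring, zpow_add₀ hp0.ne', zpow_mul]
  norm_cast
  ring

lemma summable_thetaTerm (hp0 : 0 < p) (hp1 : p < 1) {x : ℝ} (hx : x ≠ 0) :
    Summable (thetaTerm x p) :=
  summable_of_ratio_zpow (pow_pos hp0 2) (pow_lt_one₀ hp0.le hp1 two_ne_zero) hx
    (thetaTerm_add_one hp0 hx)

lemma tsum_thetaTerm (hp0 : 0 < p) (hp1 : p < 1) {x y : ℝ} (hxy : x * y = p ^ 2) :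
    ∑' k, thetaTerm x p k =
      qPochInf x (p ^ 2) * qPochInf y (p ^ 2) * qPochInf (p ^ 2) (p ^ 2) := by
  have hx : x ≠ 0 := left_ne_zero_of_mul (hxy.trans_ne (pow_pos hp0 2).ne')
  exact tsum_eq_qPochInf_mul (pow_pos hp0 2) (pow_lt_one₀ hp0.le hp1 two_ne_zero) hxy
    (by simp [thetaTerm]) (thetaTerm_add_one hp0 hx)

lemma thetaTerm_monomial (hp0 : 0 < p) {z : ℝ} (e α β : ℤ) (γ : ℕ) (k : ℤ) :
    thetaTerm ((-1) ^ e * p ^ α * z ^ β) (p ^ γ) k =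
      (-1) ^ ((e + 1) * k) * p ^ (α * k + γ * (k ^ 2 - k)) * z ^ (β * k) := by
  rw [thetaTerm, zpow_mul, zpow_add_one₀ (by norm_num), zpow_add₀ hp0.ne', zpow_mul, zpow_mul,
    zpow_mul, zpow_natCast, show -((-1) ^ e * p ^ α * z ^ β) = (-1) ^ e * (-1) * p ^ α * z ^ β by
      ring, mul_zpow, mul_zpow]
  ring

lemma qPochInf_one (b : ℝ) : qPochInf 1 b = 0 :=
  tprod_of_exists_eq_zero ⟨0, by simp⟩

/-- The change of variables `(c, a, l) ↦ (a + c - 2l, a + l)`. -/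
def residueEquiv : Fin 3 × (ℤ × ℤ) ≃ ℤ × ℤ where
  toFun x := (x.2.1 + (x.1 : ℕ) - 2 * x.2.2, x.2.1 + x.2.2)
  invFun x := (⟨((x.1 + 2 * x.2) % 3).toNat, by omega⟩,
    ((x.1 + 2 * x.2) / 3, x.2 - (x.1 + 2 * x.2) / 3))
  left_inv := by
    rintro ⟨c, a, l⟩
    have := c.isLt
    refine Prod.ext (Fin.ext ?_) (Prod.ext ?_ ?_) <;> dsimp only <;> omega
  right_inv := by
    rintro ⟨n, m⟩
    refine Prod.ext ?_ ?_ <;> dsimp only <;> omega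

lemma thetaTerm_mul_thetaTerm (hp0 : 0 < p) {z : ℝ} (hz : z ≠ 0) (c : ℕ) (a l : ℤ) :
    thetaTerm z p (a + c - 2 * l) * thetaTerm (p ^ 2 * z ^ 2) (p ^ 2) (a + l) =
      thetaTerm (-(p ^ (2 + 2 * c) * z ^ 3)) (p ^ 3) a *
        thetaTerm (p ^ (8 - 4 * c : ℤ)) (p ^ 6) l * ((-z) ^ c * p ^ (c ^ 2 - c : ℤ)) := by
  have h1 := thetaTerm_monomial hp0 (z := z) 0 0 1 1 (a + c - 2 * l)
  have h2 := thetaTerm_monomial hp0 (z := z) 0 2 2 2 (a + l)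
  have h3 := thetaTerm_monomial hp0 (z := z) 1 (2 + 2 * c) 3 3 a
  have h4 := thetaTerm_monomial hp0 (z := z) 0 (8 - 4 * c) 0 6 l
  rw [show (-1 : ℝ) ^ (0 : ℤ) * p ^ (0 : ℤ) * z ^ (1 : ℤ) = z by simp, pow_one] at h1
  rw [show (-1 : ℝ) ^ (0 : ℤ) * p ^ (2 : ℤ) * z ^ (2 : ℤ) = p ^ 2 * z ^ 2 by
    rw [zpow_zero, one_mul]; norm_cast] at h2
  rw [show (-1 : ℝ) ^ (1 : ℤ) * p ^ (2 + 2 * c : ℤ) * z ^ (3 : ℤ) =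
    -(p ^ (2 + 2 * c) * z ^ 3) by
      rw [zpow_one, neg_one_mul, neg_mul]; norm_cast] at h3
  rw [show (-1 : ℝ) ^ (0 : ℤ) * p ^ (8 - 4 * c : ℤ) * z ^ (0 : ℤ) = p ^ (8 - 4 * c : ℤ) by
    simp] at h4
  have hzc : (-z) ^ c = (-1) ^ (c : ℤ) * z ^ (c : ℤ) := by
    rw [neg_pow, zpow_natCast, zpow_natCast]
  have hsplit (i j k i' j' k' : ℤ) : ((-1) ^ i * p ^ j * z ^ k) * ((-1) ^ i' * p ^ j' * z ^ k') =
      (-1) ^ (i + i') * p ^ (j + j') * z ^ (k + k') := by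
    rw [zpow_add₀ (by norm_num), zpow_add₀ hp0.ne', zpow_add₀ hz]
    ring
  have hrest : (-z) ^ c * p ^ (c ^ 2 - c : ℤ) =
      (-1) ^ (c : ℤ) * p ^ (c ^ 2 - c : ℤ) * z ^ (c : ℤ) := by
    rw [hzc]
    ring
  rw [h1, h2, h3, h4, hrest, hsplit, hsplit, hsplit]
  congr 1
  · congr 1
    · rw [show (0 + 1) * (a + c - 2 * l) + (0 + 1) * (a + l) =
        ((1 + 1) * a + (0 + 1) * l + c) + 2 * (-l) by ring, zpow_add₀ (by norm_num), zpow_mul]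
      norm_num
    · congr 1
      push_cast
      ring
  · congr 1
    ring

/-- Euler's pentagonal number theorem, from Jacobi's triple product. -/
lemma tsum_thetaTerm_pentagonal (hp0 : 0 < p) (hp1 : p < 1) :
    ∑' l, thetaTerm (p ^ 8) (p ^ 6) l = qPochInf (p ^ 4) (p ^ 4) ∧
      ∑' l, thetaTerm (p ^ 4) (p ^ 6) l = qPochInf (p ^ 4) (p ^ 4) := by
  have h6 : p ^ 6 < 1 := pow_lt_one₀ hp0.le hp1 (by norm_num)
  rw [tsum_thetaTerm (pow_pos hp0 6) h6 (show p ^ 8 * p ^ 4 = (p ^ 6) ^ 2 by ring),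
    tsum_thetaTerm (pow_pos hp0 6) h6 (show p ^ 4 * p ^ 8 = (p ^ 6) ^ 2 by ring),
    qPochInf_eq_prod (pow_pos hp0 4) (pow_lt_one₀ hp0.le hp1 (by norm_num)) _ three_ne_zero]
  simp only [Finset.prod_range_succ, Finset.prod_range_zero, one_mul]
  ring_nf
  exact ⟨trivial, trivial⟩

/-- The **quintuple product identity** in base `p²`. -/
theorem quintuple_product_s5 (hp0 : 0 < p) (hp1 : p < 1) {z y : ℝ} (hzy : z * y = p ^ 2) :
    (qPochInf z (p ^ 2) * qPochInf y (p ^ 2) * qPochInf (p ^ 2) (p ^ 2)) *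
        (qPochInf (p ^ 2 * z ^ 2) (p ^ 4) * qPochInf (y ^ 2 * (p ^ 2)⁻¹) (p ^ 4)) =
      ∑' a, thetaTerm (-(p ^ 2 * z ^ 3)) (p ^ 3) a -
        z * ∑' a, thetaTerm (-(p ^ 4 * z ^ 3)) (p ^ 3) a := by
  have hz : z ≠ 0 := left_ne_zero_of_mul (hzy.trans_ne (pow_pos hp0 2).ne')
  have hpow (n : ℕ) (hn : n ≠ 0) : p ^ n < 1 := pow_lt_one₀ hp0.le hp1 hn
  have hs1 := (summable_thetaTerm hp0 hp1 hz).norm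
  have hs2 := (summable_thetaTerm (pow_pos hp0 2) (hpow 2 two_ne_zero)
    (x := p ^ 2 * z ^ 2) (by positivity)).norm
  have hne : qPochInf (p ^ 4) (p ^ 4) ≠ 0 :=
    (qPochInf_pos (pow_pos hp0 4) (hpow 4 (by norm_num)) (by positivity)
      (hpow 4 (by norm_num))).ne'
  have ht1 := tsum_thetaTerm hp0 hp1 hzy
  have ht2 := tsum_thetaTerm (pow_pos hp0 2) (hpow 2 two_ne_zero)
    (x := p ^ 2 * z ^ 2) (y := y ^ 2 * (p ^ 2)⁻¹) (by
      rw [show p ^ 2 * z ^ 2 * (y ^ 2 * (p ^ 2)⁻¹) = p ^ 2 * (p ^ 2)⁻¹ * (z * y) ^ 2 by ring, hzy]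
      field_simp)
  have hsum : Summable fun x ↦ thetaTerm z p (residueEquiv x).1 *
      thetaTerm (p ^ 2 * z ^ 2) (p ^ 2) (residueEquiv x).2 :=
    residueEquiv.summable_iff.mpr (summable_mul_of_summable_norm hs1 hs2)
  have hprod := tsum_mul_tsum_of_summable_norm hs1 hs2
  rw [ht1, ht2, ← residueEquiv.tsum_eq, hsum.tsum_prod, tsum_fintype, Fin.sum_univ_three] at hprod
  have hfactor (c : Fin 3) : ∑' x : ℤ × ℤ, thetaTerm z p (residueEquiv (c, x)).1 *
      thetaTerm (p ^ 2 * z ^ 2) (p ^ 2) (residueEquiv (c, x)).2 =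
      (∑' a, thetaTerm (-(p ^ (2 + 2 * (c : ℕ)) * z ^ 3)) (p ^ 3) a) *
      (∑' l, thetaTerm (p ^ (8 - 4 * (c : ℕ) : ℤ)) (p ^ 6) l) *
      ((-z) ^ (c : ℕ) * p ^ ((c : ℕ) ^ 2 - (c : ℕ) : ℤ)) := by
    rw [tsum_mul_tsum_of_summable_norm
      (summable_thetaTerm (pow_pos hp0 3) (hpow 3 three_ne_zero)
        (neg_ne_zero.2 (mul_ne_zero (pow_pos hp0 _).ne' (pow_ne_zero 3 hz)))).norm
      (summable_thetaTerm (pow_pos hp0 6) (hpow 6 (by norm_num)) (zpow_pos hp0 _).ne').norm,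
      ← tsum_mul_right]
    exact tsum_congr fun x ↦ thetaTerm_mul_thetaTerm hp0 hz c x.1 x.2
  have hzero : ∑' l, thetaTerm 1 (p ^ 6) l = 0 := by
    rw [tsum_thetaTerm (pow_pos hp0 6) (hpow 6 (by norm_num)) (one_mul _), qPochInf_one]
    ring
  obtain ⟨hpent, hpent'⟩ := tsum_thetaTerm_pentagonal hp0 hp1
  rw [hfactor, hfactor, hfactor] at hprod
  norm_num at hprod
  rw [hzero, hpent, hpent', show (p ^ 2) ^ 2 = p ^ 4 by ring] at hprod
  refine mul_right_cancel₀ hne ?_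
  linear_combination hprod

end QuintupleProduct

section Characters

lemma summable_zpow_quadratic_s5 {q : ℝ} (hq0 : 0 < q) (hq1 : q < 1) {A : ℕ} (hA : A ≠ 0)
    (B C : ℤ) : Summable fun k : ℤ ↦ q ^ (A * k ^ 2 + B * k + C) := by
  have hne := hq0.ne'
  refine summable_of_ratio_zpow (z := -q ^ (A + B : ℤ)) (pow_pos hq0 (2 * A))
    (pow_lt_one₀ hq0.le hq1 (by omega)) (neg_ne_zero.2 (zpow_ne_zero _ hne)) fun k ↦ ?_
  rw [neg_neg, ← zpow_natCast, ← zpow_mul, ← zpow_add₀ hne, ← zpow_add₀ hne]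
  congr 1
  push_cast
  ring

lemma tsum_int_even_add_odd {f : ℤ → ℝ} (hf : Summable f) :
    ∑' k, f k = ∑' k, f (2 * k) + ∑' k, f (2 * k + 1) := by
  have he : Function.Injective fun k : ℤ ↦ 2 * k := mul_right_injective₀ two_ne_zero
  have ho : Function.Injective fun k : ℤ ↦ 2 * k + 1 := (add_left_injective 1).comp he
  refine HasSum.tsum_eq (((he.hasSum_range_iff.2 (hf.comp_injective he).hasSum).add_isCompl ?_
    (ho.hasSum_range_iff.2 (hf.comp_injective ho).hasSum)))
  simpa [Function.comp_def] using Int.isCompl_even_odd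

variable {q : ℝ}

/-- The theta series of the difference of the two `(5, 6)` characters, as a quintuple product. -/
lemma tsum_sub_tsum_eq_quintuple (hq0 : 0 < q) (hq1 : q < 1) :
    (∑' k : ℤ, (q ^ (30 * k ^ 2 + k) - q ^ (30 * k ^ 2 + 11 * k + 1))) -
        q ^ 3 * (∑' k : ℤ, (q ^ (30 * k ^ 2 - 19 * k) - q ^ (30 * k ^ 2 + 31 * k + 5))) =
      (qPochInf q (q ^ 5) * qPochInf (q ^ 4) (q ^ 5) * qPochInf (q ^ 5) (q ^ 5)) *
        (qPochInf (q ^ 7) (q ^ 10) * qPochInf (q ^ 3) (q ^ 10)) := by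
  obtain ⟨p, hp0, rfl⟩ : ∃ p : ℝ, 0 < p ∧ q = p ^ 2 :=
    ⟨√q, Real.sqrt_pos.2 hq0, (Real.sq_sqrt hq0.le).symm⟩
  have hp1 : p < 1 := by
    by_contra! h
    exact hq1.not_ge (one_le_pow₀ h)
  have hne := hp0.ne'
  have hr0 : 0 < p ^ 5 := pow_pos hp0 5
  have hr1 : p ^ 5 < 1 := pow_lt_one₀ hp0.le hp1 (by norm_num)
  have hquint := quintuple_product_s5 hr0 hr1 (z := p ^ 2) (y := p ^ 8) (by ring)
  have hs (B C : ℤ) := summable_zpow_quadratic_s5 hq0 hq1 (A := 30) (by norm_num) B C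
  have hterm (e : ℕ) (k : ℤ) : thetaTerm (-((p ^ 5) ^ e * (p ^ 2) ^ 3)) ((p ^ 5) ^ 3) k =
      p ^ (15 * k ^ 2 + (5 * e - 9) * k) := by
    have h := thetaTerm_monomial hp0 (z := 1) 1 (5 * e + 6) 0 15 k
    rw [one_zpow, one_zpow, mul_one, mul_one, zpow_one, zpow_mul] at h
    norm_num at h
    rw [show (p ^ 5) ^ 3 = p ^ 15 by ring, show (p ^ 5) ^ e * (p ^ 2) ^ 3 = p ^ (5 * e + 6 : ℤ) by
      norm_cast; ring, h]
    congr 1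
    ring
  have hsum (e : ℕ) : Summable (thetaTerm (-((p ^ 5) ^ e * (p ^ 2) ^ 3)) ((p ^ 5) ^ 3)) :=
    summable_thetaTerm (pow_pos hr0 3) (pow_lt_one₀ hr0.le hr1 three_ne_zero)
      (neg_ne_zero.2 (by positivity))
  have hA : ∑' a, thetaTerm (-((p ^ 5) ^ 2 * (p ^ 2) ^ 3)) ((p ^ 5) ^ 3) a =
      ∑' k : ℤ, (p ^ 2) ^ (30 * k ^ 2 + k) +
        (p ^ 2) ^ 3 * ∑' k : ℤ, (p ^ 2) ^ (30 * k ^ 2 + 31 * k + 5) := by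
    rw [tsum_int_even_add_odd (hsum 2), ← tsum_mul_left]
    congr 1 <;> refine tsum_congr fun k ↦ ?_ <;>
      rw [hterm] <;> simp only [← zpow_natCast, ← zpow_mul, ← zpow_add₀ hne] <;> congr 1 <;>
      push_cast <;> ring
  have hB : p ^ 2 * ∑' a, thetaTerm (-((p ^ 5) ^ 4 * (p ^ 2) ^ 3)) ((p ^ 5) ^ 3) a =
      ∑' k : ℤ, (p ^ 2) ^ (30 * k ^ 2 + 11 * k + 1) +
        (p ^ 2) ^ 3 * ∑' k : ℤ, (p ^ 2) ^ (30 * k ^ 2 - 19 * k) := by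
    rw [tsum_int_even_add_odd (hsum 4), mul_add, ← tsum_mul_left, ← tsum_mul_left,
      ← tsum_mul_left, ← (Equiv.addRight (1 : ℤ)).tsum_eq
        fun k : ℤ ↦ (p ^ 2) ^ 3 * (p ^ 2) ^ (30 * k ^ 2 - 19 * k)]
    congr 1 <;> refine tsum_congr fun k ↦ ?_ <;>
      rw [hterm] <;> simp only [Equiv.coe_addRight, ← zpow_natCast, ← zpow_mul, ← zpow_add₀ hne] <;>
      congr 1 <;> push_cast <;> ring
  have h1 := hs 1 0
  have h2 := hs 11 1
  have h3 := hs (-19) 0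
  have h4 := hs 31 5
  simp only [Nat.cast_ofNat, one_mul, add_zero, neg_mul, ← sub_eq_add_neg] at h1 h2 h3 h4
  rw [h1.tsum_sub h2, h3.tsum_sub h4]
  rw [hA, hB, show (p ^ 8) ^ 2 * ((p ^ 5) ^ 2)⁻¹ = p ^ 6 by field_simp] at hquint
  simp only [← pow_mul, ← pow_add] at hquint ⊢
  norm_num at hquint ⊢
  linear_combination -hquint

/-- The theta series of the `(2, 5)` character, as a triple product. -/
lemma tsum_eq_triple (hq0 : 0 < q) (hq1 : q < 1) :
    ∑' k : ℤ, ((q ^ 2) ^ (10 * k ^ 2 + k) - (q ^ 2) ^ (10 * k ^ 2 + 9 * k + 2)) =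
      qPochInf (q ^ 6) (q ^ 10) * qPochInf (q ^ 4) (q ^ 10) * qPochInf (q ^ 10) (q ^ 10) := by
  have hne := hq0.ne'
  have h5 : q ^ 5 < 1 := pow_lt_one₀ hq0.le hq1 (by norm_num)
  have htriple := tsum_thetaTerm (pow_pos hq0 5) h5 (show q ^ 6 * q ^ 4 = (q ^ 5) ^ 2 by ring)
  have hs (B C : ℤ) := summable_zpow_quadratic_s5 (pow_pos hq0 2)
    (pow_lt_one₀ hq0.le hq1 two_ne_zero) (A := 10) (by norm_num) B C
  have h1 := hs 1 0
  have h2 := hs 9 2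
  simp only [Nat.cast_ofNat, one_mul, add_zero] at h1 h2
  have hterm (k : ℤ) : thetaTerm (q ^ 6) (q ^ 5) k = (-1) ^ k * q ^ (5 * k ^ 2 + k) := by
    have h := thetaTerm_monomial hq0 (z := 1) 0 6 0 5 k
    rw [one_zpow, one_zpow, mul_one, mul_one, zpow_zero, one_mul, zero_add, one_mul] at h
    norm_cast at h
    rw [h, show 6 * k + 5 * (k ^ 2 - k) = 5 * k ^ 2 + k by ring]
    norm_num
  rw [← pow_mul, tsum_int_even_add_odd (summable_thetaTerm (pow_pos hq0 5) h5
    (pow_pos hq0 6).ne')] at htriple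
  rw [h1.tsum_sub h2, ← htriple, sub_eq_add_neg, ← tsum_neg,
    ← ((Equiv.neg ℤ).trans (Equiv.addRight (-1 : ℤ))).tsum_eq
      fun k : ℤ ↦ -(q ^ 2) ^ (10 * k ^ 2 + 9 * k + 2)]
  congr 1 <;> refine tsum_congr fun k ↦ ?_
  · rw [hterm, zpow_mul, ← zpow_natCast q 2, ← zpow_mul]
    norm_num
    ring_nf
  · rw [hterm, zpow_add₀ (neg_ne_zero.2 (one_ne_zero (α := ℝ))), zpow_mul (-1 : ℝ), ← zpow_natCast q 2, ← zpow_mul]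
    simp only [Equiv.trans_apply, Equiv.neg_apply, Equiv.coe_addRight]
    norm_num
    ring_nf

lemma eulerProd_eq_qPochInf (x : ℝ) : eulerProd x = qPochInf x x :=
  tprod_congr fun i ↦ by rw [pow_succ']

end Characters

theorem chi_5_6_diff_eq_chi_2_5_1_2_sq (q : ℝ) (hq0 : 0 < q) (hq1 : q < 1) :
    minChar 5 6 1 1 q - minChar 5 6 1 5 q = minChar 2 5 1 2 (q ^ 2) := by
  have hpos (n : ℕ) : 0 < q ^ n := pow_pos hq0 n
  have hlt (n : ℕ) (hn : n ≠ 0) : q ^ n < 1 := pow_lt_one₀ hq0.le hq1 hn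
  have hsplit (m d : ℕ) (hm : m ≠ 0) (hd : d ≠ 0) (x : ℝ) :
      qPochInf x (q ^ d) = ∏ r ∈ Finset.range m, qPochInf (x * (q ^ d) ^ r) ((q ^ d) ^ m) :=
    qPochInf_eq_prod (hpos d) (hlt d hd) x hm
  have hodd : qPochInf q (q ^ 2) ≠ 0 :=
    (qPochInf_pos (hpos 2) (hlt 2 (by norm_num)) hq0.le hq1).ne'
  have heuler : qPochInf q q = qPochInf q (q ^ 2) * qPochInf (q ^ 2) (q ^ 2) := by
    have h := hsplit 2 1 two_ne_zero one_ne_zero q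
    simp only [Finset.prod_range_succ, Finset.prod_range_zero, one_mul, pow_one, pow_zero, mul_one,
      ← sq] at h
    exact h
  have hprod : (qPochInf q (q ^ 5) * qPochInf (q ^ 4) (q ^ 5) * qPochInf (q ^ 5) (q ^ 5)) *
        (qPochInf (q ^ 7) (q ^ 10) * qPochInf (q ^ 3) (q ^ 10)) = qPochInf q (q ^ 2) *
      (qPochInf (q ^ 6) (q ^ 10) * qPochInf (q ^ 4) (q ^ 10) * qPochInf (q ^ 10) (q ^ 10)) := by
    rw [hsplit 5 2 (by norm_num) (by norm_num) q, hsplit 2 5 (by norm_num) (by norm_num) q,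
      hsplit 2 5 (by norm_num) (by norm_num) (q ^ 4),
      hsplit 2 5 (by norm_num) (by norm_num) (q ^ 5)]
    simp only [Finset.prod_range_succ, Finset.prod_range_zero]
    ring_nf
  have hexp1 : q ^ (3 + -1 / 30 : ℝ) = q ^ 3 * q ^ (-1 / 30 : ℝ) := by
    rw [Real.rpow_add hq0]
    norm_cast
  have hexp2 : (q ^ 2) ^ (-1 / 60 : ℝ) = q ^ (-1 / 30 : ℝ) := by
    rw [← Real.rpow_natCast, ← Real.rpow_mul hq0.le]
    norm_num
  have hquint := tsum_sub_tsum_eq_quintuple hq0 hq1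
  have htriple := tsum_eq_triple hq0 hq1
  rw [hprod] at hquint
  have hc1 : minChar 5 6 1 1 q = q ^ (-1 / 30 : ℝ) * (qPochInf q q)⁻¹ *
      ∑' k : ℤ, (q ^ (30 * k ^ 2 + k) - q ^ (30 * k ^ 2 + 11 * k + 1)) := by
    rw [minChar, eulerProd_eq_qPochInf]
    norm_num
  have hc2 : minChar 5 6 1 5 q = q ^ 3 * q ^ (-1 / 30 : ℝ) * (qPochInf q q)⁻¹ *
      ∑' k : ℤ, (q ^ (30 * k ^ 2 - 19 * k) - q ^ (30 * k ^ 2 + 31 * k + 5)) := by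
    rw [minChar, eulerProd_eq_qPochInf, ← hexp1]
    norm_num
    refine Or.inl (tsum_congr fun k ↦ ?_)
    rw [mul_comm k 19, ← sub_eq_add_neg]
  have hc3 : minChar 2 5 1 2 (q ^ 2) = q ^ (-1 / 30 : ℝ) * (qPochInf (q ^ 2) (q ^ 2))⁻¹ *
      ∑' k : ℤ, ((q ^ 2) ^ (10 * k ^ 2 + k) - (q ^ 2) ^ (10 * k ^ 2 + 9 * k + 2)) := by
    rw [minChar, eulerProd_eq_qPochInf, ← hexp2]
    norm_num
  rw [hc1, hc2, hc3, htriple, heuler, mul_inv]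
  rw [show ∀ E F H S T : ℝ, E * (F * H) * S - q ^ 3 * E * (F * H) * T =
    E * (F * H) * (S - q ^ 3 * T) by intros; ring, hquint]
  field_simp
end
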